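/- Fix k ≥ 0 and let R^{(m)} ∈ 𝒩 = {0,…,k,∞} be the row-growth indicators of the Plancherel growth process, and let λ^{(m)} denote its m-th diagram. Let (R̃^{(n+1)}, …, R̃^{(n+ℓ)}, λ̃^{(n+ℓ)}) be a vector of mutually independent random variables, independent of the process, with R̃^{(n+i)} distributed as R^{(n+i)} for each 1 ≤ i ≤ ℓ and λ̃^{(n+ℓ)} distributed as λ^{(n+ℓ)}. Then there exists a sequence c_n = o(1/√n) such that for every ℓ and every i ∈ {1,…,ℓ}, the total variation distance between the vectors (R̃^{(n+1)},…,R̃^{(n+i−1)}, R^{(n+i)}, R^{(n+i+1)},…,R^{(n+ℓ)}, λ^{(n+ℓ)}) and (R̃^{(n+1)},…,R̃^{(n+i−1)}, R̃^{(n+i)}, R^{(n+i+1)},…,R^{(n+ℓ)}, λ^{(n+ℓ)}) is at most c_{n+i}. -/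

import Mathlib

open MeasureTheory Filter

/-- The number of standard Young tableaux of shape `μ`: bijective fillings of the cells of `μ`
by `0, 1, …, μ.card - 1` that are strictly increasing along rows and columns. -/
noncomputable def sytCount (μ : YoungDiagram) : ℕ :=
  Nat.card {T : μ.cells → Fin μ.card //
    Function.Bijective T ∧
      ∀ a b : μ.cells, (a : ℕ × ℕ).1 ≤ (b : ℕ × ℕ).1 → (a : ℕ × ℕ).2 ≤ (b : ℕ × ℕ).2 →
        a ≠ b → T a < T b}

/-- `lam 0 ↗ lam 1 ↗ ⋯` is a Plancherel growth process: the probability of any prescribed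
initial path `∅ = μ⁽⁰⁾ ↗ μ⁽¹⁾ ↗ ⋯ ↗ μ⁽ⁿ⁾` in the Young graph equals `d_{μ⁽ⁿ⁾} / n!`,
which characterizes the distribution of the sequence of RSK shapes of an i.i.d. uniform
sequence. -/
def IsPlancherelGrowthProcess {Ω : Type*} [MeasurableSpace Ω] (P : Measure Ω)
    (lam : ℕ → Ω → YoungDiagram) : Prop :=
  IsProbabilityMeasure P ∧
  (∀ (n : ℕ) (y : YoungDiagram), MeasurableSet {ω | lam n ω = y}) ∧
  ∀ (n : ℕ) (path : ℕ → YoungDiagram), path 0 = ⊥ →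
    (∀ i, i < n → path i ≤ path (i + 1) ∧ (path (i + 1)).card = (path i).card + 1) →
    P {ω | ∀ i ≤ n, lam i ω = path i} =
      (sytCount (path n) : ENNReal) / (Nat.factorial n : ENNReal)

/-- The event `E_r⁽ⁿ⁺¹⁾` that the box added in step `n+1` of the growth process
(i.e. the unique box of `λ⁽ⁿ⁺¹⁾ ∖ λ⁽ⁿ⁾`) lies in the row with index `r`. -/
def growthEvent {Ω : Type*} (lam : ℕ → Ω → YoungDiagram) (n r : ℕ) : Set Ω :=
  {ω | (lam (n + 1) ω).rowLen r = (lam n ω).rowLen r + 1}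

/-- The element of `𝒩 = {0,1,…,k,∞}` (encoded as `Option (Fin (k+1))`, with `none = ∞`)
recording in which of the bottom `k+1` rows the growth from `μ` to `ν` occurred, or `∞`
(i.e. `none`) if it occurred in a higher row. -/
noncomputable def rowIdx (k : ℕ) (μ ν : YoungDiagram) : Option (Fin (k + 1)) :=
  if h : ∃ r : Fin (k + 1), ν.rowLen r = μ.rowLen r + 1 then some h.choose else none


namespace PG

set_option linter.unusedSimpArgs false

theorem rl_eq {μ : YoungDiagram} {i x : ℕ} (h : ∀ j, (i, j) ∈ μ ↔ j < x) : μ.rowLen i = x := by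
  apply le_antisymm
  · by_contra hc
    push Not at hc
    have := (YoungDiagram.mem_iff_lt_rowLen (μ := μ)).2 hc
    rw [h] at this
    omega
  · by_contra hc
    push Not at hc
    have := (h _).2 hc
    rw [YoungDiagram.mem_iff_lt_rowLen] at this
    omega

theorem yd_ext {μ ν : YoungDiagram} (h : ∀ i, μ.rowLen i = ν.rowLen i) : μ = ν := by
  apply YoungDiagram.ext
  ext ⟨i, j⟩
  have h1 := YoungDiagram.mem_iff_lt_rowLen (μ := μ) (i := i) (j := j)
  have h2 := YoungDiagram.mem_iff_lt_rowLen (μ := ν) (i := i) (j := j)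
  rw [YoungDiagram.mem_cells, YoungDiagram.mem_cells, h1, h2, h]

theorem rl_anti (μ : YoungDiagram) {i j : ℕ} (h : i ≤ j) : μ.rowLen j ≤ μ.rowLen i :=
  μ.rowLen_anti _ _ h

def Addable (μ : YoungDiagram) (r : ℕ) : Prop := ∀ i < r, μ.rowLen r < μ.rowLen i

def Removable (μ : YoungDiagram) (r : ℕ) : Prop := μ.rowLen (r + 1) < μ.rowLen r

open Classical in
noncomputable def add (μ : YoungDiagram) (r : ℕ) : YoungDiagram :=
  if h : Addable μ r then
    ⟨insert (r, μ.rowLen r) μ.cells, by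
      rintro ⟨a, b⟩ ⟨c, d⟩ ⟨h1, h2⟩ hab
      simp only [Finset.coe_insert, Set.mem_insert_iff, Finset.mem_coe, YoungDiagram.mem_cells,
        YoungDiagram.mem_iff_lt_rowLen, Prod.mk.injEq] at hab ⊢
      simp only at h1 h2
      rcases hab with ⟨rfl, rfl⟩ | hab
      · rcases h1.lt_or_eq with h3 | h3
        · right; exact lt_of_le_of_lt h2 (h _ h3)
        · subst h3
          rcases h2.lt_or_eq with h4 | h4
          · right; exact h4
          · left; exact ⟨rfl, h4⟩
      · right
        have := rl_anti μ h1
        omega⟩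
  else μ

open Classical in
noncomputable def rem (μ : YoungDiagram) (r : ℕ) : YoungDiagram :=
  if h : Removable μ r then
    ⟨μ.cells.erase (r, μ.rowLen r - 1), by
      rintro ⟨a, b⟩ ⟨c, d⟩ ⟨h1, h2⟩ hab
      simp only [Finset.coe_erase, Set.mem_sdiff, Set.mem_singleton_iff, Finset.mem_coe,
        YoungDiagram.mem_cells,
        YoungDiagram.mem_iff_lt_rowLen, Prod.mk.injEq] at hab ⊢
      simp only at h1 h2
      obtain ⟨hab, hne⟩ := hab
      refine ⟨?_, ?_⟩
      · have := rl_anti μ h1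
        omega
      · rintro ⟨rfl, rfl⟩
        apply hne
        unfold Removable at h
        rcases h1.lt_or_eq with h3 | h3
        · have := rl_anti μ (show c + 1 ≤ a from h3)
          omega
        · subst h3
          omega⟩
  else μ

theorem rl_add {μ : YoungDiagram} {r : ℕ} (h : Addable μ r) (i : ℕ) :
    (add μ r).rowLen i = μ.rowLen i + if i = r then 1 else 0 := by
  apply rl_eq
  intro j
  rw [← YoungDiagram.mem_cells]
  simp only [add, h, dif_pos, Finset.mem_insert, YoungDiagram.mem_cells,
    YoungDiagram.mem_iff_lt_rowLen, Prod.mk.injEq]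
  split_ifs with h1
  · subst h1; omega
  · omega

theorem rl_rem {μ : YoungDiagram} {r : ℕ} (h : Removable μ r) (i : ℕ) :
    (rem μ r).rowLen i = μ.rowLen i - if i = r then 1 else 0 := by
  apply rl_eq
  intro j
  rw [← YoungDiagram.mem_cells]
  simp only [rem, h, dif_pos, Finset.mem_erase, YoungDiagram.mem_cells,
    YoungDiagram.mem_iff_lt_rowLen, Prod.mk.injEq, ne_eq]
  split_ifs with h1
  · subst h1; omega
  · omega

theorem card_add {μ : YoungDiagram} {r : ℕ} (h : Addable μ r) : (add μ r).card = μ.card + 1 := by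
  unfold YoungDiagram.card
  simp only [add, h, dif_pos]
  rw [Finset.card_insert_of_notMem]
  rw [YoungDiagram.mem_cells, YoungDiagram.mem_iff_lt_rowLen]
  omega

theorem card_rem {μ : YoungDiagram} {r : ℕ} (h : Removable μ r) : (rem μ r).card + 1 = μ.card := by
  unfold YoungDiagram.card
  simp only [rem, h, dif_pos]
  apply Finset.card_erase_add_one
  rw [YoungDiagram.mem_cells, YoungDiagram.mem_iff_lt_rowLen]
  unfold Removable at h
  omega

theorem addable_iff {μ : YoungDiagram} {r : ℕ} :
    Addable μ r ↔ r = 0 ∨ μ.rowLen r < μ.rowLen (r - 1) := by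
  constructor
  · intro h
    rcases Nat.eq_zero_or_pos r with h0 | h0
    · left; exact h0
    · right; exact h _ (by omega)
  · rintro (rfl | h) i hi
    · omega
    · have := rl_anti μ (show i ≤ r - 1 by omega)
      omega

theorem removable_add {μ : YoungDiagram} {r : ℕ} (h : Addable μ r) : Removable (add μ r) r := by
  unfold Removable
  rw [rl_add h, rl_add h]
  have := rl_anti μ (show r ≤ r + 1 by omega)
  simp
  omega

theorem addable_rem {μ : YoungDiagram} {r : ℕ} (h : Removable μ r) : Addable (rem μ r) r := by
  intro i hi
  rw [rl_rem h, rl_rem h]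
  have := rl_anti μ hi.le
  unfold Removable at h
  rw [if_pos rfl, if_neg (by omega)]
  omega

theorem rem_add {μ : YoungDiagram} {r : ℕ} (h : Addable μ r) : rem (add μ r) r = μ := by
  apply yd_ext
  intro i
  rw [rl_rem (removable_add h), rl_add h]
  omega

theorem add_rem {μ : YoungDiagram} {r : ℕ} (h : Removable μ r) : add (rem μ r) r = μ := by
  apply yd_ext
  intro i
  rw [rl_add (addable_rem h), rl_rem h]
  unfold Removable at h
  split_ifs with h1
  · subst h1; omega
  · omega

theorem col_le_card (μ : YoungDiagram) (r : ℕ) (h : ∀ i < r, 0 < μ.rowLen i) : r ≤ μ.card := by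
  have : (Finset.range r).image (fun i => (i, 0)) ⊆ μ.cells := by
    intro x hx
    simp only [Finset.mem_image, Finset.mem_range] at hx
    obtain ⟨i, hi, rfl⟩ := hx
    rw [YoungDiagram.mem_cells, YoungDiagram.mem_iff_lt_rowLen]
    exact h i hi
  have h2 := Finset.card_le_card this
  rwa [Finset.card_image_of_injective _ (fun a b hab => by simpa using hab), Finset.card_range] at h2

theorem rl_le_card (μ : YoungDiagram) (r : ℕ) : μ.rowLen r ≤ μ.card := by
  rw [YoungDiagram.rowLen_eq_card]
  exact Finset.card_le_card (Finset.filter_subset _ _)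

theorem addable_le {μ : YoungDiagram} {r : ℕ} (h : Addable μ r) : r ≤ μ.card :=
  col_le_card μ r (fun i hi => by have := h i hi; omega)

theorem removable_lt {μ : YoungDiagram} {r : ℕ} (h : Removable μ r) : r < μ.card := by
  have := col_le_card μ (r+1) (fun i hi => by
    have := rl_anti μ (show i ≤ r by omega)
    unfold Removable at h
    omega)
  omega

open Classical in
noncomputable def A (μ : YoungDiagram) : Finset ℕ := (Finset.range (μ.card + 1)).filter (Addable μ)

open Classical in
noncomputable def R (μ : YoungDiagram) : Finset ℕ := (Finset.range μ.card).filter (Removable μ)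

theorem mem_A {μ : YoungDiagram} {r : ℕ} : r ∈ A μ ↔ Addable μ r := by
  simp only [A, Finset.mem_filter, Finset.mem_range]
  constructor
  · exact fun h => h.2
  · exact fun h => ⟨by have := addable_le h; omega, h⟩

theorem mem_R {μ : YoungDiagram} {r : ℕ} : r ∈ R μ ↔ Removable μ r := by
  simp only [R, Finset.mem_filter, Finset.mem_range]
  constructor
  · exact fun h => h.2
  · exact fun h => ⟨removable_lt h, h⟩

theorem finite_level (n : ℕ) : {μ : YoungDiagram | μ.card = n}.Finite := by
  have hfin : {s : Finset (ℕ × ℕ) | s ⊆ Finset.range (n) ×ˢ Finset.range (n)}.Finite := by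
    have := (Finset.finite_toSet (Finset.powerset (Finset.range (n) ×ˢ Finset.range (n))))
    refine this.subset ?_
    intro s hs
    exact Finset.mem_coe.2 (Finset.mem_powerset.2 hs)
  have h2 := hfin.preimage (f := YoungDiagram.cells)
    (fun a _ b _ hab => YoungDiagram.ext hab)
  refine h2.subset ?_
  intro μ hμ
  simp only [Set.mem_preimage, Set.mem_ofPred_eq] at hμ ⊢
  rintro ⟨i, j⟩ hij
  rw [YoungDiagram.mem_cells] at hij
  have h3 := YoungDiagram.mem_iff_lt_rowLen.1 hij
  have h4 := rl_le_card μ i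
  have h5 := col_le_card μ (i+1) (fun k hk => by
    have := rl_anti μ (show k ≤ i by omega)
    omega)
  simp only [Finset.mem_product, Finset.mem_range]
  omega

noncomputable def Y (n : ℕ) : Finset YoungDiagram := (finite_level n).toFinset

theorem mem_Y {n : ℕ} {μ : YoungDiagram} : μ ∈ Y n ↔ μ.card = n := by simp [Y]

theorem Y_zero : Y 0 = {⊥} := by
  ext μ
  rw [mem_Y, Finset.mem_singleton]
  constructor
  · intro h
    apply YoungDiagram.ext
    unfold YoungDiagram.card at h
    rw [Finset.card_eq_zero] at h
    rw [h]; rfl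
  · rintro rfl; rfl

/-- Exchange of summation between consecutive levels. -/
theorem sum_exchange (n : ℕ) (g : YoungDiagram → YoungDiagram → ℕ → ℝ) :
    ∑ ν ∈ Y (n + 1), ∑ a ∈ R ν, g ν (rem ν a) a = ∑ μ ∈ Y n, ∑ b ∈ A μ, g (add μ b) μ b := by
  rw [Finset.sum_sigma', Finset.sum_sigma']
  refine Finset.sum_bij' (fun x _ => ⟨rem x.1 x.2, x.2⟩) (fun x _ => ⟨add x.1 x.2, x.2⟩) ?_ ?_ ?_ ?_ ?_
  · rintro ⟨ν, a⟩ h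
    simp only [Finset.mem_sigma, mem_Y, mem_A, mem_R] at h ⊢
    have := card_rem h.2
    exact ⟨by omega, addable_rem h.2⟩
  · rintro ⟨ν, a⟩ h
    simp only [Finset.mem_sigma, mem_Y, mem_A, mem_R] at h ⊢
    have := card_add h.2
    exact ⟨by omega, removable_add h.2⟩
  · rintro ⟨ν, a⟩ h
    simp only [Finset.mem_sigma, mem_Y, mem_A, mem_R] at h ⊢
    rw [add_rem h.2]
  · rintro ⟨ν, a⟩ h
    simp only [Finset.mem_sigma, mem_Y, mem_A, mem_R] at h ⊢
    rw [rem_add h.2]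
  · rintro ⟨ν, a⟩ h
    simp only [Finset.mem_sigma, mem_Y, mem_A, mem_R] at h ⊢
    rw [add_rem h.2]

/-- signed corner sum -/
noncomputable def e (φ : ℤ → ℝ) (μ : YoungDiagram) : ℝ :=
  ∑ b ∈ A μ, φ (μ.rowLen b - b) - ∑ a ∈ R μ, φ (μ.rowLen a - a - 1)

theorem swap_iff {μ : YoungDiagram} {a b : ℕ} (hab : a ≠ b) :
    (Addable μ b ∧ Removable (add μ b) a) ↔ (Removable μ a ∧ Addable (rem μ a) b) := by
  constructor
  · rintro ⟨h1, h2⟩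
    have h3 : Removable μ a := by
      unfold Removable at h2 ⊢
      rw [rl_add h1, rl_add h1, if_neg hab] at h2
      omega
    refine ⟨h3, ?_⟩
    intro i hi
    rw [rl_rem h3, rl_rem h3, if_neg hab.symm]
    have := h1 i hi
    split_ifs with h4
    · subst h4
      unfold Removable at h2
      rw [rl_add h1, rl_add h1, if_neg hab] at h2
      have := rl_anti μ (show i + 1 ≤ b from hi)
      split_ifs at h2 with h5
      · subst h5; omega
      · have := h1 (i+1) (by omega)
        omega
    · omega
  · rintro ⟨h1, h2⟩
    have h3 : Addable μ b := by
      intro i hi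
      have := h2 i hi
      rw [rl_rem h1, rl_rem h1, if_neg hab.symm] at this
      omega
    refine ⟨h3, ?_⟩
    unfold Removable at h1 ⊢
    rw [rl_add h3, rl_add h3, if_neg hab]
    split_ifs with h5
    · have := h2 a (by omega)
      rw [rl_rem h1, rl_rem h1, if_neg hab.symm, if_pos rfl] at this
      subst h5
      omega
    · omega

theorem swap_eq {μ : YoungDiagram} {a b : ℕ} (hab : a ≠ b) (h1 : Addable μ b)
    (h2 : Removable (add μ b) a) : rem (add μ b) a = add (rem μ a) b := by
  obtain ⟨h3, h4⟩ := (swap_iff hab).1 ⟨h1, h2⟩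
  apply yd_ext
  intro i
  rw [rl_rem h2, rl_add h1, rl_add h4, rl_rem h3]
  split_ifs <;> omega

/-- commutation relation -/
theorem comm (φ : ℤ → ℝ) (h : YoungDiagram → ℝ) (μ : YoungDiagram) :
    ∑ b ∈ A μ, φ (μ.rowLen b - b) * ∑ a ∈ R (add μ b), h (rem (add μ b) a) =
      e φ μ * h μ +
      ∑ a ∈ R μ, ∑ b ∈ A (rem μ a), φ ((rem μ a).rowLen b - b) * h (add (rem μ a) b) := by
  have L : ∀ b ∈ A μ, φ (μ.rowLen b - b) * ∑ a ∈ R (add μ b), h (rem (add μ b) a) =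
      φ (μ.rowLen b - b) * h μ +
      ∑ a ∈ (R (add μ b)).erase b, φ (μ.rowLen b - b) * h (rem (add μ b) a) := by
    intro b hb
    rw [mem_A] at hb
    rw [← Finset.add_sum_erase _ _ (mem_R.2 (removable_add hb)), rem_add hb, mul_add, Finset.mul_sum]
  have L2 : ∀ a ∈ R μ, ∑ b ∈ A (rem μ a), φ ((rem μ a).rowLen b - b) * h (add (rem μ a) b) =
      φ (μ.rowLen a - a - 1) * h μ +
      ∑ b ∈ (A (rem μ a)).erase a, φ ((rem μ a).rowLen b - b) * h (add (rem μ a) b) := by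
    intro a ha
    rw [mem_R] at ha
    rw [← Finset.add_sum_erase _ _ (mem_A.2 (addable_rem ha)), add_rem ha, rl_rem ha, if_pos rfl]
    congr 3
    unfold Removable at ha
    push_cast [show 1 ≤ μ.rowLen a by omega]
    ring
  rw [Finset.sum_congr rfl L, Finset.sum_congr rfl L2, Finset.sum_add_distrib,
    Finset.sum_add_distrib, ← Finset.sum_mul, ← Finset.sum_mul, e, sub_mul]
  have : ∑ b ∈ A μ, ∑ a ∈ (R (add μ b)).erase b, φ (μ.rowLen b - b) * h (rem (add μ b) a) =
      ∑ a ∈ R μ, ∑ b ∈ (A (rem μ a)).erase a, φ ((rem μ a).rowLen b - b) * h (add (rem μ a) b) := by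
    rw [Finset.sum_comm' (s' := fun a => (A (rem μ a)).erase a) (t' := R μ)]
    · apply Finset.sum_congr rfl
      intro a ha
      apply Finset.sum_congr rfl
      intro b hb
      rw [Finset.mem_erase, mem_A] at hb
      rw [mem_R] at ha
      obtain ⟨h3, h4⟩ := (swap_iff hb.1.symm).2 ⟨ha, hb.2⟩
      rw [swap_eq hb.1.symm h3 h4, rl_rem ha, if_neg hb.1]
      simp
    · intro b a
      simp only [Finset.mem_erase, mem_A, mem_R]
      constructor
      · rintro ⟨h1, h2, h3⟩
        obtain ⟨h4, h5⟩ := (swap_iff h2).1 ⟨h1, h3⟩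
        exact ⟨⟨h2.symm, h5⟩, h4⟩
      · rintro ⟨⟨h2, h5⟩, h4⟩
        obtain ⟨h1, h3⟩ := (swap_iff h2.symm).2 ⟨h4, h5⟩
        exact ⟨h1, h2.symm, h3⟩
  rw [this]
  ring

theorem rl_zero {μ : YoungDiagram} {N : ℕ} (hN : μ.card ≤ N) : μ.rowLen N = 0 := by
  by_contra h
  have := col_le_card μ (N+1) (fun i hi => by
    have := rl_anti μ (show i ≤ N by omega)
    omega)
  omega

theorem e_formula (φ : ℤ → ℝ) (μ : YoungDiagram) (N : ℕ) (hN : μ.card ≤ N) :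
    e φ μ = φ (-N) + ∑ i ∈ Finset.range N, (φ (μ.rowLen i - i) - φ (μ.rowLen i - i - 1)) := by
  classical
  have h1 : ∑ b ∈ A μ, φ (μ.rowLen b - b) =
      ∑ b ∈ Finset.range (N+1), if Addable μ b then φ (μ.rowLen b - b) else 0 := by
    rw [← Finset.sum_filter]
    apply Finset.sum_congr _ (fun _ _ => rfl)
    ext r
    simp only [mem_A, Finset.mem_filter, Finset.mem_range]
    exact ⟨fun h => ⟨by have := addable_le h; omega, h⟩, fun h => h.2⟩
  have h2 : ∑ b ∈ R μ, φ (μ.rowLen b - b - 1) =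
      ∑ b ∈ Finset.range N, if Removable μ b then φ (μ.rowLen b - b - 1) else 0 := by
    rw [← Finset.sum_filter]
    apply Finset.sum_congr _ (fun _ _ => rfl)
    ext r
    simp only [mem_R, Finset.mem_filter, Finset.mem_range]
    exact ⟨fun h => ⟨by have := removable_lt h; omega, h⟩, fun h => h.2⟩
  rw [e, h1, h2, Finset.sum_range_succ']
  have h3 : ∀ i, (if Addable μ (i+1) then φ (μ.rowLen (i+1) - (i+1 : ℕ)) else 0) -
      (if Removable μ i then φ (μ.rowLen i - i - 1) else 0) =
      φ (μ.rowLen (i+1) - (i+1 : ℕ)) - φ (μ.rowLen i - i - 1) := by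
    intro i
    have hx : Addable μ (i+1) ↔ Removable μ i := by
      rw [addable_iff]; unfold Removable; simp
    by_cases hr : Removable μ i
    · rw [if_pos (hx.2 hr), if_pos hr]
    · rw [if_neg (fun h => hr (hx.1 h)), if_neg hr]
      have := rl_anti μ (show i ≤ i+1 by omega)
      have : μ.rowLen (i+1) = μ.rowLen i := by unfold Removable at hr; omega
      rw [this]
      push_cast
      rw [sub_add_eq_sub_sub]
      ring
  have h4 : Addable μ 0 := by rw [addable_iff]; left; rfl
  rw [if_pos h4]
  have h5 := Finset.sum_congr (rfl : Finset.range N = Finset.range N) (fun i _ => h3 i)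
  rw [Finset.sum_sub_distrib, Finset.sum_sub_distrib] at h5
  have h6 := Finset.sum_range_succ' (fun i : ℕ => φ (μ.rowLen i - i)) N
  have h7 := Finset.sum_range_succ (fun i : ℕ => φ (μ.rowLen i - i)) N
  rw [rl_zero hN] at h7
  rw [Finset.sum_sub_distrib]
  simp only [Nat.cast_zero, zero_sub] at h7 h6 ⊢
  linarith

theorem e_add (φ : ℤ → ℝ) {μ : YoungDiagram} {b : ℕ} (h : Addable μ b) :
    e φ (add μ b) = e φ μ + (φ (μ.rowLen b - b + 1) + φ (μ.rowLen b - b - 1)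
      - 2 * φ (μ.rowLen b - b)) := by
  rw [e_formula φ (add μ b) (μ.card + 1) (by rw [card_add h]),
    e_formula φ μ (μ.card + 1) (by omega)]
  have hb : b ∈ Finset.range (μ.card + 1) := by
    rw [Finset.mem_range]; have := addable_le h; omega
  rw [← Finset.add_sum_erase _ _ hb, ← Finset.add_sum_erase _ _ hb]
  have : ∀ i ∈ (Finset.range (μ.card + 1)).erase b,
    (φ ((add μ b).rowLen i - i) - φ ((add μ b).rowLen i - i - 1)) =
    (φ (μ.rowLen i - i) - φ (μ.rowLen i - i - 1)) := by
    intro i hi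
    rw [Finset.mem_erase] at hi
    rw [rl_add h, if_neg hi.1, add_zero]
  rw [Finset.sum_congr rfl this, rl_add h, if_pos rfl]
  push_cast
  rw [show (μ.rowLen b : ℤ) + 1 - b = μ.rowLen b - b + 1 by ring,
   show (μ.rowLen b : ℤ) - b + 1 - 1 = μ.rowLen b - b by ring]
  ring

theorem e_bot (φ : ℤ → ℝ) : e φ ⊥ = φ 0 := by
  rw [e_formula φ ⊥ 0 (by rfl)]
  simp

end PG

namespace PG

def S (ν : YoungDiagram) : Set (ℕ × ℕ → ℕ) :=
  {T | (∀ c, c ∉ ν → T c = 0) ∧ (∀ c, c ∈ ν → T c < ν.card) ∧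
    (∀ m < ν.card, ∃ c, c ∈ ν ∧ T c = m) ∧
    ∀ a b : ℕ × ℕ, a ∈ ν → b ∈ ν → a.1 ≤ b.1 → a.2 ≤ b.2 → a ≠ b → T a < T b}

theorem syt_bij (ν : YoungDiagram) : ∃ f : {T : ν.cells → Fin ν.card //
    Function.Bijective T ∧
      ∀ a b : ν.cells, (a : ℕ × ℕ).1 ≤ (b : ℕ × ℕ).1 → (a : ℕ × ℕ).2 ≤ (b : ℕ × ℕ).2 →
        a ≠ b → T a < T b} → S ν, Function.Bijective f := by
  classical
  refine ⟨fun T => ⟨fun c => if h : c ∈ ν.cells then (T.1 ⟨c, h⟩ : ℕ) else 0, ?_, ?_, ?_, ?_⟩, ?_, ?_⟩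
  · intro c hc
    beta_reduce
    rw [dif_neg (by simpa using hc)]
  · intro c hc
    beta_reduce
    rw [dif_pos (by simpa using hc)]
    exact Fin.is_lt _
  · intro m hm
    obtain ⟨c, hc⟩ := T.2.1.2 ⟨m, hm⟩
    refine ⟨c.1, (YoungDiagram.mem_cells _).1 c.2, ?_⟩
    beta_reduce
    rw [dif_pos c.2]
    simp [hc]
  · intro a b ha hb h1 h2 h3
    beta_reduce
    rw [dif_pos ((YoungDiagram.mem_cells _).2 ha), dif_pos ((YoungDiagram.mem_cells _).2 hb)]
    exact T.2.2 ⟨a, _⟩ ⟨b, _⟩ h1 h2 (by simpa using h3)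
  · intro T T' h
    apply Subtype.ext
    funext c
    have := congrFun (congrArg Subtype.val h) c.1
    simp only [dif_pos c.2] at this
    exact Fin.ext this
  · rintro ⟨T, h1, h2, h3, h4⟩
    have hsurj : Function.Surjective
        (fun c : ν.cells => (⟨T c.1, h2 _ ((YoungDiagram.mem_cells _).1 c.2)⟩ : Fin ν.card)) := by
      intro m
      obtain ⟨c, hc, hc2⟩ := h3 m.1 m.2
      exact ⟨⟨c, (YoungDiagram.mem_cells _).2 hc⟩, Fin.ext hc2⟩
    refine ⟨⟨fun c => ⟨T c.1, h2 _ ((YoungDiagram.mem_cells _).1 c.2)⟩, ?_, ?_⟩, ?_⟩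
    · rw [Fintype.bijective_iff_surjective_and_card]
      refine ⟨hsurj, ?_⟩
      simp [YoungDiagram.card]
    · intro a b h5 h6 h7
      exact h4 a.1 b.1 ((YoungDiagram.mem_cells _).1 a.2) ((YoungDiagram.mem_cells _).1 b.2) h5 h6
        (fun h => h7 (Subtype.ext h))
    · apply Subtype.ext
      funext c
      by_cases hc : c ∈ ν.cells
      · simp only [dif_pos hc]
      · simp only [dif_neg hc]
        exact (h1 c (by simpa using hc)).symm

theorem syt_card (ν : YoungDiagram) : sytCount ν = Nat.card (S ν) := by
  obtain ⟨f, hf⟩ := syt_bij ν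
  exact Nat.card_eq_of_bijective f hf

instance finite_S (ν : YoungDiagram) : Finite (S ν) := by
  obtain ⟨f, hf⟩ := syt_bij ν
  exact Finite.of_surjective f hf.2

theorem mem_rem {μ : YoungDiagram} {r : ℕ} (h : Removable μ r) (c : ℕ × ℕ) :
    c ∈ rem μ r ↔ c ∈ μ ∧ c ≠ (r, μ.rowLen r - 1) := by
  rw [← YoungDiagram.mem_cells]
  simp only [rem, h, dif_pos, Finset.mem_erase, YoungDiagram.mem_cells]
  tauto

theorem corner_mem {μ : YoungDiagram} {r : ℕ} (h : Removable μ r) : (r, μ.rowLen r - 1) ∈ μ := by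
  rw [YoungDiagram.mem_iff_lt_rowLen]
  unfold Removable at h
  omega

theorem ext_mem (ν : YoungDiagram) {a : ℕ} (ha : Removable ν a) (T : S (rem ν a)) :
    Function.update T.1 (a, ν.rowLen a - 1) (ν.card - 1) ∈ S ν := by
  classical
  obtain ⟨T, h1, h2, h3, h4⟩ := T
  have hc := card_rem ha
  have key : ∀ x, x ≠ (a, ν.rowLen a - 1) → x ∈ ν → x ∈ rem ν a := fun x hx hx' =>
    (mem_rem ha x).2 ⟨hx', hx⟩
  refine ⟨?_, ?_, ?_, ?_⟩
  · intro c hc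
    have hne : c ≠ (a, ν.rowLen a - 1) := by
      rintro rfl; exact hc (corner_mem ha)
    rw [Function.update_of_ne hne]
    exact h1 c (fun h => hc ((mem_rem ha c).1 h).1)
  · intro c hcν
    by_cases hne : c = (a, ν.rowLen a - 1)
    · rw [hne, Function.update_self]; omega
    · rw [Function.update_of_ne hne]
      have := h2 c (key c hne hcν)
      simp only
      omega
  · intro m hm
    by_cases hm' : m = ν.card - 1
    · exact ⟨_, corner_mem ha, by rw [Function.update_self, hm']⟩
    · obtain ⟨c, hc1, hc2⟩ := h3 m (by omega)
      rw [mem_rem ha] at hc1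
      exact ⟨c, hc1.1, by rw [Function.update_of_ne hc1.2]; exact hc2⟩
  · intro x y hx hy hxy1 hxy2 hne
    by_cases hx1 : x = (a, ν.rowLen a - 1)
    · exfalso
      apply hne
      obtain ⟨y1, y2⟩ := y
      subst hx1
      simp only at hxy1 hxy2
      rw [YoungDiagram.mem_iff_lt_rowLen] at hy
      unfold Removable at ha
      rcases hxy1.lt_or_eq with h | h
      · have := rl_anti ν (show a + 1 ≤ y1 from h)
        omega
      · subst h
        rw [Prod.mk.injEq]
        omega
    · rw [Function.update_of_ne hx1]
      have := h2 x (key x hx1 hx)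
      by_cases hy1 : y = (a, ν.rowLen a - 1)
      · rw [hy1, Function.update_self]
        simp only
        omega
      · rw [Function.update_of_ne hy1]
        exact h4 x y (key x hx1 hx) (key y hy1 hy) hxy1 hxy2 hne

theorem syt_rec (ν : YoungDiagram) (hν : 0 < ν.card) :
    sytCount ν = ∑ a ∈ R ν, sytCount (rem ν a) := by
  classical
  simp only [syt_card]
  rw [← Finset.sum_coe_sort (R ν) (fun a => Nat.card (S (rem ν a))), ← Nat.card_sigma]
  symm
  apply Nat.card_eq_of_bijective
    (fun x : (Σ a : R ν, S (rem ν a)) =>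
      (⟨_, ext_mem ν (mem_R.1 x.1.2) x.2⟩ : S ν))
  constructor
  · rintro ⟨⟨a, ha⟩, T⟩ ⟨⟨a', ha'⟩, T'⟩ h
    rw [mem_R] at ha ha'
    have hf := congrArg Subtype.val h
    simp only at hf
    have haa : a = a' := by
      by_contra hne
      have h1 := congrFun hf (a, ν.rowLen a - 1)
      have hne2 : (a, ν.rowLen a - 1) ≠ (a', ν.rowLen a' - 1) := by
        rw [Ne, Prod.mk.injEq]; tauto
      rw [Function.update_self, Function.update_of_ne hne2] at h1
      have := T'.2.2.1 _ ((mem_rem ha' _).2 ⟨corner_mem ha, hne2⟩)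
      have := card_rem ha'
      simp only at *
      omega
    subst haa
    have : T = T' := by
      apply Subtype.ext
      funext x
      by_cases hx : x = (a, ν.rowLen a - 1)
      · have hx' : x ∉ rem ν a := by rw [mem_rem ha]; tauto
        rw [T.2.1 x hx', T'.2.1 x hx']
      · have h1 := congrFun hf x
        rwa [Function.update_of_ne hx, Function.update_of_ne hx] at h1
    rw [this]
  · rintro ⟨T, h1, h2, h3, h4⟩
    obtain ⟨⟨i, j⟩, hc, hTc⟩ := h3 (ν.card - 1) (by omega)
    have hj : ν.rowLen i = j + 1 := by
      have := YoungDiagram.mem_iff_lt_rowLen.1 hc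
      by_contra hne
      have h5 : (i, j+1) ∈ ν := by rw [YoungDiagram.mem_iff_lt_rowLen]; omega
      have h6 := h4 (i,j) (i,j+1) hc h5 (by simp) (by simp) (by simp)
      have := h2 _ h5
      omega
    have hr : Removable ν i := by
      unfold Removable
      by_contra hne
      have h5 : (i+1, j) ∈ ν := by rw [YoungDiagram.mem_iff_lt_rowLen]; omega
      have h6 := h4 (i,j) (i+1,j) hc h5 (by simp) (by simp) (by simp)
      have := h2 _ h5
      omega
    have hcor : (i, ν.rowLen i - 1) = (i, j) := by rw [hj]; simp
    have hcard := card_rem hr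
    refine ⟨⟨⟨i, mem_R.2 hr⟩, ⟨Function.update T (i, j) 0, ?_, ?_, ?_, ?_⟩⟩, ?_⟩
    · intro c hc'
      rw [mem_rem hr, hcor] at hc'
      by_cases hx : c = (i, j)
      · rw [hx, Function.update_self]
      · rw [Function.update_of_ne hx]
        exact h1 c (by tauto)
    · intro c hc'
      rw [mem_rem hr, hcor] at hc'
      rw [Function.update_of_ne hc'.2]
      have h5 := h2 c hc'.1
      have : c.1 ≤ i ∨ i < c.1 := by omega
      by_contra hlt
      have heq : T c = ν.card - 1 := by simp only at hlt; omega
      -- injectivity from surjectivity: counting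
      have himg : ν.cells.image T = Finset.range ν.card := by
        ext m
        simp only [Finset.mem_image, YoungDiagram.mem_cells, Finset.mem_range]
        constructor
        · rintro ⟨x, hx, rfl⟩; exact h2 x hx
        · intro hm; exact h3 m hm
      have hinj : Set.InjOn T ν.cells := by
        rw [← Finset.card_image_iff, himg, Finset.card_range]
      apply hc'.2
      apply hinj
      · exact Finset.mem_coe.2 ((YoungDiagram.mem_cells _).2 hc'.1)
      · exact Finset.mem_coe.2 ((YoungDiagram.mem_cells _).2 hc)
      · rw [heq, hTc]
    · intro m hm
      simp only at hm
      obtain ⟨c, hc1, hc2⟩ := h3 m (by omega)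
      have hx : c ≠ (i, j) := by rintro rfl; omega
      exact ⟨c, by rw [mem_rem hr, hcor]; exact ⟨hc1, hx⟩, by rw [Function.update_of_ne hx, hc2]⟩
    · intro x y hx hy hxy1 hxy2 hne
      rw [mem_rem hr, hcor] at hx hy
      rw [Function.update_of_ne hx.2, Function.update_of_ne hy.2]
      exact h4 x y hx.1 hy.1 hxy1 hxy2 hne
    · apply Subtype.ext
      simp only [hcor]
      rw [Function.update_idem, ← hTc, Function.update_eq_self]

theorem syt_bot : sytCount ⊥ = 1 := by
  rw [syt_card, Nat.card_eq_one_iff_unique]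
  refine ⟨⟨?_⟩, ⟨⟨fun _ => 0, fun _ _ => rfl, ?_, ?_, ?_⟩⟩⟩
  · rintro ⟨T, hT⟩ ⟨T', hT'⟩
    apply Subtype.ext
    funext c
    change T c = T' c
    rw [hT.1 c (YoungDiagram.notMem_bot c), hT'.1 c (YoungDiagram.notMem_bot c)]
  · intro c hc; exact absurd hc (YoungDiagram.notMem_bot c)
  · intro m hm; exact absurd hm (by simp [YoungDiagram.card])
  · intro a b ha; exact absurd ha (YoungDiagram.notMem_bot a)

noncomputable def d (ν : YoungDiagram) : ℝ := sytCount ν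

theorem d_bot : d ⊥ = 1 := by simp [d, syt_bot]

theorem d_nonneg (ν : YoungDiagram) : 0 ≤ d ν := by simp [d]

theorem d_rec {ν : YoungDiagram} (hν : 0 < ν.card) : d ν = ∑ a ∈ R ν, d (rem ν a) := by
  simp [d, syt_rec ν hν]

theorem R_nonempty {ν : YoungDiagram} (hν : 0 < ν.card) : (R ν).Nonempty := by
  by_contra h
  rw [Finset.not_nonempty_iff_eq_empty] at h
  have h0 : ∀ i, ν.rowLen 0 ≤ ν.rowLen i := by
    intro i
    induction i with
    | zero => exact le_rfl
    | succ i ih =>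
      have : i ∉ R ν := by simp [h]
      rw [mem_R] at this
      unfold Removable at this
      omega
  have h1 := h0 ν.card
  rw [rl_zero le_rfl] at h1
  have : ν.cells = ∅ := by
    rw [Finset.eq_empty_iff_forall_notMem]
    rintro ⟨i, j⟩ hx
    rw [YoungDiagram.mem_cells, YoungDiagram.mem_iff_lt_rowLen] at hx
    have := rl_anti ν (Nat.zero_le i)
    omega
  unfold YoungDiagram.card at hν
  rw [this] at hν
  simp at hν

theorem d_pos (ν : YoungDiagram) : 0 < d ν := by
  induction hn : ν.card generalizing ν with
  | zero =>
    have : ν ∈ Y 0 := mem_Y.2 hn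
    rw [Y_zero, Finset.mem_singleton] at this
    rw [this, d_bot]; norm_num
  | succ n ih =>
    rw [d_rec (by omega)]
    apply Finset.sum_pos
    · intro a ha
      have := card_rem (mem_R.1 ha)
      exact ih _ (by omega)
    · exact R_nonempty (by omega)

end PG

namespace PG

theorem e_one (μ : YoungDiagram) : e (fun _ => 1) μ = 1 := by
  rw [e_formula _ μ μ.card le_rfl]; simp

noncomputable def Dn (h : YoungDiagram → ℝ) (μ : YoungDiagram) : ℝ := ∑ b ∈ A μ, h (add μ b)
noncomputable def Up (h : YoungDiagram → ℝ) (μ : YoungDiagram) : ℝ := ∑ a ∈ R μ, h (rem μ a)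

theorem Dn_Up (h : YoungDiagram → ℝ) (μ : YoungDiagram) : Dn (Up h) μ = h μ + Up (Dn h) μ := by
  have := comm (fun _ => 1) h μ
  rw [e_one] at this
  simp only [one_mul] at this
  exact this

theorem Up_d {ν : YoungDiagram} (hν : 0 < ν.card) : Up d ν = d ν := (d_rec hν).symm

theorem R_empty {ν : YoungDiagram} (hν : ν.card = 0) : R ν = ∅ := by
  rw [Finset.eq_empty_iff_forall_notMem]
  intro r hr
  have := removable_lt (mem_R.1 hr)
  omega

theorem Dn_d (μ : YoungDiagram) : Dn d μ = (μ.card + 1) * d μ := by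
  induction hn : μ.card generalizing μ with
  | zero =>
    have h1 : Dn d μ = Dn (Up d) μ := by
      apply Finset.sum_congr rfl
      intro b hb
      rw [Up_d (by rw [card_add (mem_A.1 hb)]; omega)]
    rw [h1, Dn_Up, Up, R_empty hn]
    simp
  | succ n ih =>
    have h1 : Dn d μ = Dn (Up d) μ := by
      apply Finset.sum_congr rfl
      intro b hb
      rw [Up_d (by rw [card_add (mem_A.1 hb)]; omega)]
    have h2 : Up (Dn d) μ = (n + 1) * Up d μ := by
      rw [Up, Up, Finset.mul_sum]
      apply Finset.sum_congr rfl
      intro a ha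
      have := card_rem (mem_R.1 ha)
      rw [ih _ (by omega)]
    rw [h1, Dn_Up, h2, Up_d (by omega)]
    push_cast
    ring

theorem adj (n : ℕ) (f h : YoungDiagram → ℝ) :
    ∑ ν ∈ Y (n + 1), f ν * Up h ν = ∑ μ ∈ Y n, Dn f μ * h μ := by
  simp only [Up, Dn, Finset.mul_sum, Finset.sum_mul]
  exact sum_exchange n (fun ν μ _ => f ν * h μ)

theorem pos_of_Y {n : ℕ} {ν : YoungDiagram} (h : ν ∈ Y (n + 1)) : 0 < ν.card := by
  rw [mem_Y] at h; omega

theorem adj_d (n : ℕ) (f : YoungDiagram → ℝ) :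
    ∑ ν ∈ Y (n + 1), f ν * d ν = ∑ μ ∈ Y n, Dn f μ * d μ := by
  rw [← adj]
  apply Finset.sum_congr rfl
  intro ν hν
  rw [Up_d (pos_of_Y hν)]

theorem sum_sq (n : ℕ) : ∑ ν ∈ Y n, d ν ^ 2 = n.factorial := by
  induction n with
  | zero => simp [Y_zero, d_bot]
  | succ n ih =>
    simp only [pow_two] at ih ⊢
    rw [adj_d, Nat.factorial_succ]
    push_cast
    rw [← ih, Finset.mul_sum]
    apply Finset.sum_congr rfl
    intro μ hμ
    rw [Dn_d, mem_Y.1 hμ]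
    ring

theorem poincare (n : ℕ) (h : YoungDiagram → ℝ) (h0 : ∑ ν ∈ Y (n + 1), h ν * d ν = 0) :
    ∑ μ ∈ Y n, Dn h μ ^ 2 ≤ n * ∑ ν ∈ Y (n + 1), h ν ^ 2 := by
  induction n generalizing h with
  | zero =>
    rw [adj_d] at h0
    simp only [Y_zero, Finset.sum_singleton, d_bot, mul_one] at h0 ⊢
    rw [h0]; simp
  | succ n ih =>
    have h1 : ∑ ν ∈ Y (n + 1), Dn h ν * d ν = 0 := by rw [← adj_d, h0]
    have h2 := ih (Dn h) h1
    set G := ∑ μ ∈ Y (n + 1), Dn h μ ^ 2 with hG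
    have h3 : G = ∑ ν ∈ Y (n + 2), h ν * Up (Dn h) ν := by
      rw [adj, hG]; simp only [pow_two]
    have h4 : ∑ ν ∈ Y (n + 2), Up (Dn h) ν ^ 2 = G + ∑ μ ∈ Y n, Dn (Dn h) μ ^ 2 := by
      simp only [pow_two, hG]
      rw [adj]
      simp only [Dn_Up, add_mul, Finset.sum_add_distrib]
      congr 1
      rw [← adj]
      apply Finset.sum_congr rfl
      intros; ring
    have h5 := Finset.sum_mul_sq_le_sq_mul_sq (Y (n + 2)) h (Up (Dn h))
    rw [← h3, h4] at h5
    set H := ∑ ν ∈ Y (n + 2), h ν ^ 2 with hH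
    have hH0 : 0 ≤ H := Finset.sum_nonneg (fun _ _ => sq_nonneg _)
    have hG0 : 0 ≤ G := Finset.sum_nonneg (fun _ _ => sq_nonneg _)
    push_cast
    have h6 : G ^ 2 ≤ H * ((n + 1) * G) := by
      refine h5.trans (mul_le_mul_of_nonneg_left ?_ hH0)
      linarith
    rcases hG0.lt_or_eq with hG1 | hG1
    · have : G * G ≤ ((n + 1) * H) * G := by nlinarith
      exact le_of_mul_le_mul_right this hG1
    · show G ≤ (n + 1) * H
      rw [← hG1]; positivity

open Classical in
noncomputable def g (r : ℕ) (ν : YoungDiagram) : ℝ := if r ∈ R ν then d (rem ν r) else 0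

noncomputable def p (r n : ℕ) : ℝ := (∑ ν ∈ Y n, d ν * g r ν) / n.factorial

noncomputable def E (n : ℕ) (f : YoungDiagram → ℝ) : ℝ := (∑ ν ∈ Y n, f ν * d ν ^ 2) / n.factorial

theorem fac_ne (n : ℕ) : (n.factorial : ℝ) ≠ 0 := by exact_mod_cast Nat.factorial_ne_zero n
theorem fac_pos (n : ℕ) : (0:ℝ) < (n.factorial : ℝ) := by exact_mod_cast Nat.factorial_pos n

theorem g_nonneg (r : ℕ) (ν : YoungDiagram) : 0 ≤ g r ν := by
  unfold g; split_ifs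
  · exact d_nonneg _
  · exact le_rfl

theorem p_nonneg (r n : ℕ) : 0 ≤ p r n :=
  div_nonneg (Finset.sum_nonneg (fun ν _ => mul_nonneg (d_nonneg ν) (g_nonneg r ν))) (fac_pos n).le

theorem sum_g (n r : ℕ) (G : YoungDiagram → ℝ → ℝ) (hG : ∀ ν, G ν 0 = 0) :
    ∑ ν ∈ Y (n + 1), G ν (g r ν) =
      ∑ μ ∈ Y n, if r ∈ A μ then G (add μ r) (d μ) else 0 := by
  classical
  have := sum_exchange n (fun ν μ a => if a = r then G ν (d μ) else 0)
  simp only [Finset.sum_ite_eq'] at this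
  rw [← this]
  apply Finset.sum_congr rfl
  intro ν _
  unfold g
  split_ifs
  · rfl
  · rw [hG]

theorem sum_g_sq (n r : ℕ) : ∑ ν ∈ Y (n + 1), g r ν ^ 2 ≤ n.factorial := by
  rw [sum_g n r (fun _ x => x ^ 2) (by simp), ← sum_sq]
  apply Finset.sum_le_sum
  intro μ _
  split_ifs
  · exact le_rfl
  · positivity

theorem p_eq (n r : ℕ) : p r (n + 1) * (n + 1).factorial =
    ∑ μ ∈ Y n, d μ * (if r ∈ A μ then d (add μ r) else 0) := by
  rw [p, div_mul_cancel₀ _ (fac_ne _), sum_g n r (fun ν x => d ν * x) (by simp)]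
  apply Finset.sum_congr rfl
  intro μ _
  split_ifs
  · ring
  · ring

theorem p_le (r n : ℕ) : p r (n + 1) ≤ 1 / Real.sqrt (n + 1 : ℕ) := by
  have h1 := Finset.sum_mul_sq_le_sq_mul_sq (Y (n + 1)) d (g r)
  rw [sum_sq] at h1
  have h2 := sum_g_sq n r
  have h3 : (p r (n + 1) * (n + 1).factorial) ^ 2 ≤ (n + 1).factorial * n.factorial := by
    rw [p, div_mul_cancel₀ _ (fac_ne _)]
    exact h1.trans (mul_le_mul_of_nonneg_left h2 (fac_pos _).le)
  have hp := p_nonneg r (n + 1)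
  rw [le_div_iff₀ (Real.sqrt_pos.2 (by positivity))]
  have h4 : (p r (n+1)) ^ 2 * (n + 1 : ℕ) ≤ 1 := by
    have hf := fac_pos n
    rw [Nat.factorial_succ] at h3
    push_cast at h3 ⊢
    have hn : (0:ℝ) < (n:ℝ) + 1 := by positivity
    have : ((p r (n+1)) ^ 2 * (n + 1 )) * ((n+1) * (n.factorial : ℝ) ^ 2)
      ≤ 1 * ((n+1) * (n.factorial : ℝ) ^ 2) := by nlinarith
    exact le_of_mul_le_mul_right this (by positivity)
  have h5 : (p r (n + 1) * Real.sqrt (n + 1 : ℕ)) ^ 2 ≤ 1 := by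
    rw [mul_pow, Real.sq_sqrt (by positivity)]; exact h4
  nlinarith [mul_nonneg hp (Real.sqrt_nonneg ((n + 1 : ℕ) : ℝ))]

theorem E_succ (n : ℕ) (f : YoungDiagram → ℝ) :
    E (n + 1) f * (n + 1).factorial = ∑ μ ∈ Y n, d μ * ∑ b ∈ A μ, f (add μ b) * d (add μ b) := by
  rw [E, div_mul_cancel₀ _ (fac_ne _)]
  have := adj_d n (fun ν => f ν * d ν)
  simp only [Dn] at this
  rw [show ∑ ν ∈ Y (n+1), f ν * d ν ^ 2 = ∑ ν ∈ Y (n+1), f ν * d ν * d ν by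
    apply Finset.sum_congr rfl; intros; ring]
  rw [this]
  apply Finset.sum_congr rfl; intros; ring

theorem sum_A_d {n : ℕ} {μ : YoungDiagram} (hμ : μ ∈ Y n) : ∑ b ∈ A μ, d (add μ b) = (n + 1) * d μ := by
  have := Dn_d μ
  rw [mem_Y.1 hμ] at this
  exact this

theorem E_eq (n : ℕ) (f : YoungDiagram → ℝ) :
    E n f * n.factorial = ∑ ν ∈ Y n, f ν * d ν ^ 2 := by
  rw [E, div_mul_cancel₀ _ (fac_ne _)]

theorem E_rowLen_succ (n r : ℕ) : E (n + 1) (fun ν => (ν.rowLen r : ℝ)) =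
    E n (fun ν => (ν.rowLen r : ℝ)) + p r (n + 1) := by
  classical
  apply mul_right_cancel₀ (fac_ne (n+1))
  rw [add_mul, E_succ, p_eq, Nat.factorial_succ]
  push_cast
  rw [mul_left_comm, E_eq, Finset.mul_sum, ← Finset.sum_add_distrib]
  apply Finset.sum_congr rfl
  intro μ hμ
  have h1 : ∑ b ∈ A μ, ((add μ b).rowLen r : ℝ) * d (add μ b) =
      μ.rowLen r * ∑ b ∈ A μ, d (add μ b) + ∑ b ∈ A μ, (if r = b then d (add μ b) else 0) := by
    rw [Finset.mul_sum, ← Finset.sum_add_distrib]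
    apply Finset.sum_congr rfl
    intro b hb
    rw [rl_add (mem_A.1 hb)]
    push_cast
    split_ifs <;> ring
  rw [h1, sum_A_d hμ, Finset.sum_ite_eq]
  ring

theorem E_rowLen (n r : ℕ) : E n (fun ν => (ν.rowLen r : ℝ)) = ∑ m ∈ Finset.range n, p r (m + 1) := by
  induction n with
  | zero =>
    simp only [E, Y_zero, Finset.sum_singleton, Finset.range_zero, Finset.sum_empty]
    rw [rl_zero (show (⊥ : YoungDiagram).card ≤ r from Nat.zero_le _)]; simp
  | succ n ih => rw [E_rowLen_succ, ih, Finset.sum_range_succ]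

theorem E_one (n : ℕ) : E n (fun _ => 1) = 1 := by
  unfold E; simp only [one_mul]; rw [sum_sq, div_self (fac_ne n)]

theorem variance_le (n r : ℕ) (m : ℝ) (hm : m = E (n + 1) (fun ν => (ν.rowLen r : ℝ))) :
    E (n + 1) (fun ν => ((ν.rowLen r : ℝ) - m) ^ 2) ≤ (n + 1) * p r (n + 1) := by
  classical
  set h : YoungDiagram → ℝ := fun ν => ((ν.rowLen r : ℝ) - m) * d ν with hh
  have h0 : ∑ ν ∈ Y (n + 1), h ν * d ν = 0 := by
    have : ∑ ν ∈ Y (n + 1), h ν * d ν =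
      ∑ ν ∈ Y (n + 1), (ν.rowLen r : ℝ) * d ν ^ 2 - m * ∑ ν ∈ Y (n + 1), d ν ^ 2 := by
      rw [Finset.mul_sum, ← Finset.sum_sub_distrib]
      apply Finset.sum_congr rfl; intros; rw [hh]; ring
    rw [this, ← E_eq, sum_sq, ← hm]; ring
  have h1 := poincare n h h0
  have h2 : E (n + 1) (fun ν => ((ν.rowLen r : ℝ) - m) ^ 2) * (n + 1).factorial =
      ∑ ν ∈ Y (n + 1), h ν ^ 2 := by
    rw [E_eq]; apply Finset.sum_congr rfl; intros; rw [hh]; ring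
  set q : YoungDiagram → ℝ := fun μ => if r ∈ A μ then d (add μ r) else 0 with hq
  have h3 : ∀ μ ∈ Y n, Dn h μ = ((μ.rowLen r : ℝ) - m) * ((n + 1) * d μ) + q μ := by
    intro μ hμ
    rw [← sum_A_d hμ, Finset.mul_sum, hq]
    simp only []
    rw [← Finset.sum_ite_eq (A μ) r (fun b => d (add μ b)), ← Finset.sum_add_distrib]
    apply Finset.sum_congr rfl
    intro b hb
    simp only [hh]
    rw [rl_add (mem_A.1 hb)]
    push_cast
    split_ifs <;> ring
  have h4 : ∑ ν ∈ Y (n + 1), h ν ^ 2 = ∑ μ ∈ Y n, d μ *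
      (((μ.rowLen r : ℝ) - m) ^ 2 * ((n + 1) * d μ) + (2 * ((μ.rowLen r : ℝ) - m) + 1) * q μ) := by
    rw [← h2, E_succ]
    apply Finset.sum_congr rfl
    intro μ hμ
    congr 1
    rw [← sum_A_d hμ, Finset.mul_sum, hq]
    simp only []
    rw [← Finset.sum_ite_eq (A μ) r (fun b => d (add μ b)), Finset.mul_sum,
      ← Finset.sum_add_distrib]
    apply Finset.sum_congr rfl
    intro b hb
    rw [rl_add (mem_A.1 hb)]
    push_cast
    split_ifs <;> ring
  have h5 : (n + 1) * ∑ ν ∈ Y (n + 1), h ν ^ 2 - ∑ μ ∈ Y n, Dn h μ ^ 2 ≤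
      (n + 1) * ∑ μ ∈ Y n, d μ * q μ := by
    rw [h4, Finset.mul_sum, Finset.mul_sum, ← Finset.sum_sub_distrib]
    apply Finset.sum_le_sum
    intro μ hμ
    rw [h3 μ hμ]
    nlinarith [sq_nonneg (q μ)]
  rw [hq, ← p_eq] at h5
  have hf := fac_pos (n + 1)
  have h6 : E (n + 1) (fun ν => ((ν.rowLen r : ℝ) - m) ^ 2) * (n + 1).factorial ≤
     ((n + 1) * p r (n + 1)) * (n + 1).factorial := by
    rw [h2]; linarith
  exact le_of_mul_le_mul_right h6 hf

/-- exponential moments of the content of the box `n+1` -/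
noncomputable def ph (t : ℝ) (x : ℤ) : ℝ := Real.exp (t * x)

noncomputable def F (t : ℝ) (n : ℕ) : ℝ :=
  (∑ μ ∈ Y n, d μ * ∑ b ∈ A μ, ph t (μ.rowLen b - b) * d (add μ b)) / (n + 1).factorial

theorem F_eq (t : ℝ) (n : ℕ) : F t n * (n + 1).factorial =
    ∑ μ ∈ Y n, d μ * ∑ b ∈ A μ, ph t (μ.rowLen b - b) * d (add μ b) := by
  rw [F, div_mul_cancel₀ _ (fac_ne _)]

noncomputable def kap (t : ℝ) : ℝ := 2 * Real.cosh t - 2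

theorem s_rec (φ : ℤ → ℝ) (μ : YoungDiagram) :
    ∑ b ∈ A μ, φ (μ.rowLen b - b) * d (add μ b) = e φ μ * d μ +
      ∑ a ∈ R μ, ∑ b ∈ A (rem μ a), φ ((rem μ a).rowLen b - b) * d (add (rem μ a) b) := by
  rw [← comm]
  apply Finset.sum_congr rfl
  intro b hb
  rw [← d_rec (by rw [card_add (mem_A.1 hb)]; omega)]

theorem E_e_succ (t : ℝ) (n : ℕ) : E (n + 1) (e (ph t)) = E n (e (ph t)) + kap t * F t n := by
  apply mul_right_cancel₀ (fac_ne (n+1))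
  rw [add_mul, E_succ, mul_assoc, F_eq, Nat.factorial_succ]
  push_cast
  rw [mul_left_comm, E_eq, Finset.mul_sum, Finset.mul_sum, ← Finset.sum_add_distrib]
  apply Finset.sum_congr rfl
  intro μ hμ
  have : ∑ b ∈ A μ, e (ph t) (add μ b) * d (add μ b) = e (ph t) μ * ∑ b ∈ A μ, d (add μ b) +
      kap t * ∑ b ∈ A μ, ph t (μ.rowLen b - b) * d (add μ b) := by
    rw [Finset.mul_sum, Finset.mul_sum, ← Finset.sum_add_distrib]
    apply Finset.sum_congr rfl
    intro b hb
    rw [e_add _ (mem_A.1 hb)]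
    have : ph t (μ.rowLen b - b + 1) + ph t (μ.rowLen b - b - 1) - 2 * ph t (μ.rowLen b - b) =
      kap t * ph t (μ.rowLen b - b) := by
      unfold ph kap
      rw [Real.cosh_eq]
      push_cast
      rw [show t * ((μ.rowLen b : ℝ) - b + 1) = t * ((μ.rowLen b : ℝ) - b) + t by ring,
       show t * ((μ.rowLen b : ℝ) - b - 1) = t * ((μ.rowLen b : ℝ) - b) + -t by ring,
       Real.exp_add, Real.exp_add]
      ring
    rw [this]; ring
  rw [this, sum_A_d hμ]
  ring

theorem E_e_zero (t : ℝ) : E 0 (e (ph t)) = 1 := by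
  simp [E, Y_zero, d_bot, e_bot, ph]

theorem F_zero (t : ℝ) : F t 0 = 1 := by
  have h := F_eq t 0
  simp only [Y_zero, Finset.sum_singleton, d_bot] at h
  rw [s_rec, e_bot, R_empty rfl, d_bot] at h
  simpa [ph] using h

theorem F_succ (t : ℝ) (n : ℕ) : (n + 2) * F t (n + 1) = E (n + 1) (e (ph t)) + (n + 1) * F t n := by
  apply mul_right_cancel₀ (fac_ne (n+1))
  have h1 := F_eq t (n + 1)
  rw [Nat.factorial_succ] at h1
  push_cast at h1
  rw [show ((n:ℝ) + 2) * F t (n + 1) * (n + 1).factorial =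
    F t (n + 1) * (((n:ℝ) + 1 + 1) * (n + 1).factorial) by ring, h1, add_mul, E_eq,
    mul_assoc, F_eq]
  rw [Finset.sum_congr rfl (fun μ (_ : μ ∈ Y (n + 1)) => by rw [s_rec, mul_add]),
    Finset.sum_add_distrib]
  congr 1
  · apply Finset.sum_congr rfl; intros; ring
  · have := adj n d (fun μ => ∑ b ∈ A μ, ph t (μ.rowLen b - b) * d (add μ b))
    simp only [Up] at this
    rw [this, Finset.mul_sum]
    apply Finset.sum_congr rfl
    intro μ hμ
    rw [Dn_d, mem_Y.1 hμ]
    ring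

theorem E_e (t : ℝ) (n : ℕ) : E n (e (ph t)) = 1 + kap t * ∑ j ∈ Finset.range n, F t j := by
  induction n with
  | zero => rw [E_e_zero]; simp
  | succ n ih => rw [E_e_succ, ih, Finset.sum_range_succ]; ring

theorem F_formula (t : ℝ) (n : ℕ) : (n + 1) * F t n =
    ∑ m ∈ Finset.range (n + 1), (1 + kap t * ∑ j ∈ Finset.range m, F t j) := by
  induction n with
  | zero => simp [F_zero]
  | succ n ih =>
    rw [Finset.sum_range_succ, ← ih, ← E_e]
    have := F_succ t n
    push_cast
    linarith

theorem kap_nonneg (t : ℝ) : 0 ≤ kap t := by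
  unfold kap; linarith [Real.one_le_cosh t]

theorem choose_diag (m q : ℕ) : ∑ j ∈ Finset.range m, j.choose q = m.choose (q + 1) := by
  induction m with
  | zero => simp
  | succ m ih => rw [Finset.sum_range_succ, ih, Nat.choose_succ_succ]; ring

theorem F_lower (t : ℝ) (q n : ℕ) : kap t ^ q * (n.choose q) / (q + 1).factorial ≤ F t n := by
  have hk := kap_nonneg t
  induction q generalizing n with
  | zero =>
    simp only [pow_zero, Nat.choose_zero_right, Nat.cast_one, mul_one, zero_add, Nat.factorial_one,
      div_one]
    induction n using Nat.strong_induction_on with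
    | _ n ih =>
      have h := F_formula t n
      have h2 : ∑ m ∈ Finset.range (n + 1), (1:ℝ) ≤
        ∑ m ∈ Finset.range (n + 1), (1 + kap t * ∑ j ∈ Finset.range m, F t j) := by
        apply Finset.sum_le_sum
        intro m hm
        rw [Finset.mem_range] at hm
        have : 0 ≤ ∑ j ∈ Finset.range m, F t j := Finset.sum_nonneg (fun j hj => by
          rw [Finset.mem_range] at hj
          have := ih j (by omega)
          linarith)
        have := mul_nonneg hk this
        linarith
      rw [← h] at h2
      simp at h2
      have hn : (0:ℝ) < n + 1 := by positivity
      nlinarith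
  | succ q ih =>
    have h := F_formula t n
    have h2 : ∑ m ∈ Finset.range (n + 1), kap t ^ (q + 1) * (m.choose (q + 1)) / (q + 1).factorial ≤
        ∑ m ∈ Finset.range (n + 1), (1 + kap t * ∑ j ∈ Finset.range m, F t j) := by
      apply Finset.sum_le_sum
      intro m hm
      have h3 : ∑ j ∈ Finset.range m, kap t ^ q * (j.choose q) / (q + 1).factorial ≤
        ∑ j ∈ Finset.range m, F t j := Finset.sum_le_sum (fun j _ => ih j)
      have h4 : ∑ j ∈ Finset.range m, kap t ^ q * (j.choose q) / (q + 1).factorial =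
         kap t ^ q * (m.choose (q+1)) / (q + 1).factorial := by
        rw [← Finset.sum_div, ← Finset.mul_sum]
        have := choose_diag m q
        rw [← this]; push_cast; rfl
      rw [h4] at h3
      have := mul_le_mul_of_nonneg_left h3 hk
      rw [pow_succ]
      have h6 : kap t ^ q * kap t * (m.choose (q + 1)) / (q + 1).factorial =
        kap t * (kap t ^ q * (m.choose (q+1)) / (q + 1).factorial) := by ring
      linarith
    rw [← h, ← Finset.sum_div, ← Finset.mul_sum] at h2
    have h5 : ∑ m ∈ Finset.range (n + 1), ((m.choose (q + 1) : ℕ) : ℝ) = ((n+1).choose (q+2) : ℕ) := by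
      have := choose_diag (n+1) (q+1)
      rw [← this]; push_cast; rfl
    rw [h5] at h2
    have h6 : ((n+1).choose (q+2) : ℝ) * (q + 2) = (n + 1) * (n.choose (q + 1)) := by
      have := Nat.add_one_mul_choose_eq n (q + 1)
      exact_mod_cast this.symm
    have h7 : ((q + 1 + 1).factorial : ℝ) = (q + 2) * (q + 1).factorial := by
      rw [Nat.factorial_succ]; push_cast; ring
    rw [h7]
    have hn : (0:ℝ) < n + 1 := by positivity
    have hq : (0:ℝ) < q + 2 := by positivity
    have hf := fac_pos (q + 1)
    rw [div_le_iff₀ (by positivity)] at h2 ⊢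
    have h8 : (kap t ^ (q + 1) * (n.choose (q + 1))) * (n + 1) ≤
      (F t n * ((q + 2) * (q + 1).factorial)) * (n + 1) := by
      calc _ = kap t ^ (q+1) * (((n+1).choose (q+2) : ℝ)) * (q + 2) := by rw [mul_assoc _ _ ((q:ℝ) + 2), h6]; ring
        _ ≤ ((n + 1) * F t n * (q + 1).factorial) * (q + 2) := mul_le_mul_of_nonneg_right h2 hq.le
        _ = _ := by ring
    exact le_of_mul_le_mul_right h8 hn

theorem F_upper (t : ℝ) (n : ℕ) : F t n ≤ Real.exp (kap t * (n + 1)) := by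
  have hk := kap_nonneg t
  induction n using Nat.strong_induction_on with
  | _ n ih =>
    have h := F_formula t n
    have h2 : ∀ m ≤ n, 1 + kap t * ∑ j ∈ Finset.range m, F t j ≤ Real.exp (kap t * (m + 1)) := by
      intro m hm
      induction m with
      | zero => simp; exact hk
      | succ m ih2 =>
        have h3 := ih2 (by omega)
        have h4 := ih m (by omega)
        rw [Finset.sum_range_succ]
        push_cast
        have h5 : Real.exp (kap t * (m + 1 + 1)) = Real.exp (kap t * (m + 1)) * Real.exp (kap t) := by
          rw [← Real.exp_add]; ring_nf
        have h6 := Real.add_one_le_exp (kap t)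
        have h7 := mul_le_mul_of_nonneg_left h6 (Real.exp_pos (kap t * (m + 1))).le
        have h8 := mul_le_mul_of_nonneg_left h4 hk
        rw [h5]
        linarith
    have h3 : ∑ m ∈ Finset.range (n + 1), (1 + kap t * ∑ j ∈ Finset.range m, F t j) ≤
       ∑ m ∈ Finset.range (n + 1), Real.exp (kap t * (n + 1)) := by
      apply Finset.sum_le_sum
      intro m hm
      rw [Finset.mem_range] at hm
      refine (h2 m (by omega)).trans (Real.exp_le_exp.2 ?_)
      apply mul_le_mul_of_nonneg_left _ hk
      have : (m:ℝ) ≤ n := by exact_mod_cast (by omega : m ≤ n)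
      linarith
    rw [← h] at h3
    simp only [Finset.sum_const, Finset.card_range, nsmul_eq_mul] at h3
    push_cast at h3
    exact le_of_mul_le_mul_left h3 (by positivity)

end PG

namespace PG

theorem swap_rem {ν : YoungDiagram} {r s : ℕ} (hrs : r < s) (h1 : Removable ν r)
    (h2 : Removable (rem ν r) s) :
    Removable ν s ∧ Removable (rem ν s) r ∧ rem (rem ν s) r = rem (rem ν r) s := by
  have h3 : Removable ν s := by
    have h := h2
    unfold Removable at h ⊢
    rw [rl_rem h1, rl_rem h1, if_neg (by omega), if_neg (by omega)] at h
    omega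
  have h4 : Removable (rem ν s) r := by
    unfold Removable
    rw [rl_rem h3, rl_rem h3, if_neg (show ¬ r = s by omega)]
    unfold Removable at h1
    omega
  refine ⟨h3, h4, ?_⟩
  apply yd_ext
  intro i
  rw [rl_rem h4, rl_rem h3, rl_rem h2, rl_rem h1]
  omega

open Classical in
noncomputable def aa (ν : YoungDiagram) (r s : ℕ) : ℝ := if r ∈ R ν then g s (rem ν r) else 0

theorem aa_le {ν : YoungDiagram} {r s : ℕ} (hrs : r < s) : aa ν r s ≤ aa ν s r := by
  unfold aa
  by_cases h1 : r ∈ R ν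
  · rw [if_pos h1]
    by_cases h2 : s ∈ R (rem ν r)
    · obtain ⟨h3, h4, h5⟩ := swap_rem hrs (mem_R.1 h1) (mem_R.1 h2)
      rw [if_pos (mem_R.2 h3)]
      unfold g
      rw [if_pos h2, if_pos (mem_R.2 h4), h5]
    · rw [g, if_neg h2]
      split_ifs
      · exact g_nonneg _ _
      · exact le_rfl
  · rw [if_neg h1]
    split_ifs
    · exact g_nonneg _ _
    · exact le_rfl

theorem R_sub {ν : YoungDiagram} {M : ℕ} (h : ν.card ≤ M) : R ν ⊆ Finset.range M := by
  intro r hr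
  have := removable_lt (mem_R.1 hr)
  rw [Finset.mem_range]; omega

theorem W_le {ν : YoungDiagram} (hν : 2 ≤ ν.card) (K : ℕ) :
    ∑ r ∈ Finset.range K, g r ν ≤ Up (fun μ => ∑ r ∈ Finset.range K, g r μ) ν := by
  classical
  set M := max K ν.card with hM
  have h1 : ∀ r, g r ν = ∑ s ∈ Finset.range M, aa ν r s := by
    intro r
    unfold g aa
    by_cases h : r ∈ R ν
    · simp only [h, if_true]
      have hc := card_rem (mem_R.1 h)
      rw [d_rec (by omega)]
      unfold g
      rw [Finset.sum_ite_mem, Finset.inter_eq_right.2 (R_sub (by omega))]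
    · simp [h]
  have h2 : Up (fun μ => ∑ r ∈ Finset.range K, g r μ) ν =
      ∑ s ∈ Finset.range M, ∑ r ∈ Finset.range K, aa ν s r := by
    unfold Up aa
    have : ∀ s, ∑ r ∈ Finset.range K, (if s ∈ R ν then g r (rem ν s) else 0) =
      if s ∈ R ν then ∑ r ∈ Finset.range K, g r (rem ν s) else 0 := by
      intro s; split_ifs <;> simp
    simp only [this]
    rw [Finset.sum_ite_mem, Finset.inter_eq_right.2 (R_sub (by omega))]
  rw [h2]
  simp only [h1]
  rw [Finset.sum_comm]
  rw [← Finset.sum_range_add_sum_Ico _ (show K ≤ M by omega),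
    ← Finset.sum_range_add_sum_Ico _ (show K ≤ M by omega)]
  rw [Finset.sum_comm]
  gcongr with s hs r hr
  rw [Finset.mem_Ico] at hs
  rw [Finset.mem_range] at hr
  exact aa_le (by omega)

theorem p_mono (K n : ℕ) : ∑ r ∈ Finset.range K, p r (n + 2) ≤ ∑ r ∈ Finset.range K, p r (n + 1) := by
  have key : ∀ m, ∑ r ∈ Finset.range K, p r m =
      (∑ ν ∈ Y m, d ν * ∑ r ∈ Finset.range K, g r ν) / m.factorial := by
    intro m
    unfold p
    rw [← Finset.sum_div]
    congr 1
    rw [Finset.sum_comm]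
    simp only [Finset.mul_sum]
  rw [key, key]
  have h1 : ∑ ν ∈ Y (n + 2), d ν * ∑ r ∈ Finset.range K, g r ν ≤
     ∑ ν ∈ Y (n + 2), d ν * Up (fun μ => ∑ r ∈ Finset.range K, g r μ) ν := by
    apply Finset.sum_le_sum
    intro ν hν
    exact mul_le_mul_of_nonneg_left (W_le (by rw [mem_Y.1 hν]; omega) K) (d_nonneg _)
  rw [adj] at h1
  have h2 : ∑ μ ∈ Y (n + 1), Dn d μ * ∑ r ∈ Finset.range K, g r μ =
     (n + 2) * ∑ μ ∈ Y (n + 1), d μ * ∑ r ∈ Finset.range K, g r μ := by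
    rw [Finset.mul_sum]
    apply Finset.sum_congr rfl
    intro μ hμ
    rw [Dn_d, mem_Y.1 hμ]; push_cast; ring
  rw [h2] at h1
  rw [div_le_div_iff₀ (fac_pos _) (fac_pos _), Nat.factorial_succ (n+1)]
  push_cast
  have := mul_le_mul_of_nonneg_right h1 (fac_pos (n+1)).le
  nlinarith

end PG

namespace PG

noncomputable def T (n : ℕ) : Finset (Σ _ : YoungDiagram, ℕ) := (Y n).sigma A
noncomputable def w (n : ℕ) (x : Σ _ : YoungDiagram, ℕ) : ℝ := d x.1 * d (add x.1 x.2) / (n + 1).factorial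
noncomputable def ct (x : Σ _ : YoungDiagram, ℕ) : ℤ := (x.1.rowLen x.2 : ℤ) - x.2

theorem w_nonneg (n : ℕ) (x) : 0 ≤ w n x :=
  div_nonneg (mul_nonneg (d_nonneg _) (d_nonneg _)) (fac_pos _).le

theorem sum_T (n : ℕ) (f : (Σ _ : YoungDiagram, ℕ) → ℝ) : ∑ x ∈ T n, w n x * f x =
    (∑ μ ∈ Y n, d μ * ∑ b ∈ A μ, f ⟨μ, b⟩ * d (add μ b)) / (n + 1).factorial := by
  unfold T w
  rw [Finset.sum_sigma, Finset.sum_div]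
  apply Finset.sum_congr rfl
  intro μ _
  rw [Finset.mul_sum, Finset.sum_div]
  apply Finset.sum_congr rfl
  intro b _
  ring

theorem F_T (t : ℝ) (n : ℕ) : F t n = ∑ x ∈ T n, w n x * ph t (ct x) := by
  rw [sum_T]; rfl

theorem sum_T_fst (n : ℕ) (f : YoungDiagram → ℝ) : ∑ x ∈ T n, w n x * f x.1 = E n f := by
  rw [sum_T, div_eq_iff (fac_ne _), Nat.factorial_succ]
  push_cast
  rw [mul_left_comm, E_eq, Finset.mul_sum]
  apply Finset.sum_congr rfl
  intro μ hμ
  rw [← Finset.mul_sum, sum_A_d hμ]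
  ring

theorem sum_T_snd (n a : ℕ) : ∑ x ∈ T n, w n x * (if x.2 = a then 1 else 0) = p a (n + 1) := by
  classical
  rw [sum_T, div_eq_iff (fac_ne _), p_eq]
  apply Finset.sum_congr rfl
  intro μ hμ
  simp only [ite_mul, one_mul, zero_mul]
  rw [Finset.sum_ite_eq']

open Classical in
noncomputable def Q (n : ℕ) (X : ℝ) : ℝ := ∑ x ∈ T n, w n x * (if X ≤ ct x then 1 else 0)

theorem Q_nonneg (n : ℕ) (X : ℝ) : 0 ≤ Q n X :=
  Finset.sum_nonneg (fun x _ => mul_nonneg (w_nonneg n x) (by split_ifs <;> simp))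

theorem F_le_Q (t X : ℝ) (ht : 0 ≤ t) (n : ℕ) :
    F t n ≤ Real.exp (t * X) + Real.sqrt (F (2 * t) n * Q n X) := by
  classical
  have h1 : F t n ≤ ∑ x ∈ T n, w n x * Real.exp (t * X) +
      ∑ x ∈ T n, w n x * (ph t (ct x) * (if X ≤ ct x then 1 else 0)) := by
    rw [F_T, ← Finset.sum_add_distrib]
    apply Finset.sum_le_sum
    intro x _
    rw [← mul_add]
    apply mul_le_mul_of_nonneg_left _ (w_nonneg n x)
    split_ifs with h
    · have := Real.exp_pos (t * X); linarith
    · push Not at h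
      have : ph t (ct x) ≤ Real.exp (t * X) := by
        unfold ph
        exact Real.exp_le_exp.2 (mul_le_mul_of_nonneg_left h.le ht)
      linarith
  have h2 : ∑ x ∈ T n, w n x * Real.exp (t * X) = Real.exp (t * X) := by
    have := sum_T_fst n (fun _ => 1)
    rw [E_one] at this
    rw [← Finset.sum_mul]
    simp only [mul_one] at this
    rw [this, one_mul]
  rw [h2] at h1
  refine h1.trans (add_le_add_right ?_ _)
  apply Real.le_sqrt_of_sq_le
  have h3 := Finset.sum_mul_sq_le_sq_mul_sq (T n) (fun x => Real.sqrt (w n x) * ph t (ct x))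
    (fun x => Real.sqrt (w n x) * (if X ≤ ct x then 1 else 0))
  have h4 : ∀ x, (Real.sqrt (w n x) * ph t (ct x)) * (Real.sqrt (w n x) * (if X ≤ ct x then 1 else 0))
     = w n x * (ph t (ct x) * (if X ≤ ct x then 1 else 0)) := by
    intro x
    have := Real.mul_self_sqrt (w_nonneg n x)
    linear_combination (ph t (ct x) * (if X ≤ ct x then 1 else 0)) * this
  have h5 : ∀ x, (Real.sqrt (w n x) * ph t (ct x)) ^ 2 = w n x * ph (2 * t) (ct x) := by
    intro x
    rw [mul_pow, Real.sq_sqrt (w_nonneg n x)]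
    unfold ph
    rw [← Real.exp_nat_mul]
    congr 2; push_cast; ring
  have h6 : ∀ x, (Real.sqrt (w n x) * (if X ≤ ct x then 1 else 0)) ^ 2 =
      w n x * (if X ≤ ct x then 1 else 0) := by
    intro x
    rw [mul_pow, Real.sq_sqrt (w_nonneg n x)]
    split_ifs <;> simp
  simp only [h4, h5, h6] at h3
  rw [F_T]
  exact h3

theorem E_mono (n : ℕ) {f g : YoungDiagram → ℝ} (h : ∀ ν, f ν ≤ g ν) : E n f ≤ E n g := by
  unfold E
  gcongr with ν _
  exact h ν

theorem E_smul (n : ℕ) (c : ℝ) (f : YoungDiagram → ℝ) : E n (fun ν => c * f ν) = c * E n f := by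
  unfold E
  rw [← mul_div_assoc, Finset.mul_sum]
  congr 1
  apply Finset.sum_congr rfl; intros; ring

theorem Q_le (n r : ℕ) (X m : ℝ) (hm : m = E (n + 1) (fun ν => (ν.rowLen r : ℝ))) (hX : m < X) :
    Q (n + 1) X ≤ r / Real.sqrt (n + 1 : ℕ) + Real.sqrt (n + 1 : ℕ) / (X - m) ^ 2 := by
  classical
  have h1 : Q (n + 1) X ≤ ∑ a ∈ Finset.range r, p a (n + 2) +
      E (n + 1) (fun ν => if X ≤ ν.rowLen r then 1 else 0) := by
    rw [← sum_T_fst]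
    simp only [← sum_T_snd]
    rw [Finset.sum_comm, ← Finset.sum_add_distrib]
    apply Finset.sum_le_sum
    rintro ⟨μ, b⟩ _
    rw [← Finset.mul_sum, ← mul_add]
    apply mul_le_mul_of_nonneg_left _ (w_nonneg _ _)
    rw [Finset.sum_ite_eq]
    simp only []
    have h00 : (0:ℝ) ≤ if X ≤ (μ.rowLen r : ℝ) then 1 else 0 := by split_ifs <;> norm_num
    by_cases hc : X ≤ (ct ⟨μ, b⟩ : ℝ)
    · rw [if_pos hc]
      by_cases hb : b < r
      · rw [if_pos (Finset.mem_range.2 hb)]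
        linarith
      · have h0 := rl_anti μ (show r ≤ b by omega)
        rw [if_neg (by simpa using hb), if_pos]
        · norm_num
        · unfold ct at hc
          push_cast at hc
          have : (μ.rowLen b : ℝ) ≤ μ.rowLen r := by exact_mod_cast h0
          have : (0:ℝ) ≤ b := by positivity
          linarith
    · rw [if_neg hc]
      have : (0:ℝ) ≤ if b ∈ Finset.range r then 1 else 0 := by split_ifs <;> norm_num
      linarith
  have h2 : ∑ a ∈ Finset.range r, p a (n + 2) ≤ r / Real.sqrt (n + 1 : ℕ) := by
    calc _ ≤ ∑ a ∈ Finset.range r, 1 / Real.sqrt (n + 1 : ℕ) := by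
          apply Finset.sum_le_sum
          intro a _
          refine (p_le a (n+1)).trans ?_
          apply one_div_le_one_div_of_le
          · exact Real.sqrt_pos.2 (by positivity)
          · apply Real.sqrt_le_sqrt; push_cast; linarith
      _ = _ := by simp [div_eq_mul_inv]
  have hX' : 0 < X - m := by linarith
  have h3 : E (n + 1) (fun ν => if X ≤ ν.rowLen r then 1 else 0) ≤
      1 / (X - m) ^ 2 * E (n + 1) (fun ν => ((ν.rowLen r : ℝ) - m) ^ 2) := by
    rw [← E_smul]
    apply E_mono
    intro ν
    split_ifs with h
    · rw [div_mul_eq_mul_div, one_mul, le_div_iff₀ (by positivity), one_mul]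
      apply pow_le_pow_left₀ hX'.le
      linarith
    · positivity
  have h4 := variance_le n r m hm
  have h5 : ((n:ℝ) + 1) * p r (n + 1) ≤ Real.sqrt (n + 1 : ℕ) := by
    have hs : (0:ℝ) < Real.sqrt (n + 1 : ℕ) := Real.sqrt_pos.2 (by positivity)
    have := p_le r n
    calc ((n:ℝ) + 1) * p r (n + 1) ≤ (n + 1) * (1 / Real.sqrt (n + 1 : ℕ)) := by gcongr
      _ = _ := by
        rw [mul_one_div, div_eq_iff hs.ne', Real.mul_self_sqrt (by positivity)]; push_cast; rfl
  have h6 : 1 / (X - m) ^ 2 * E (n + 1) (fun ν => ((ν.rowLen r : ℝ) - m) ^ 2) ≤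
     Real.sqrt (n + 1 : ℕ) / (X - m) ^ 2 := by
    rw [div_mul_eq_mul_div, one_mul]
    gcongr
    linarith
  linarith

theorem kap_ge (t : ℝ) : t ^ 2 ≤ kap t := by
  unfold kap
  wlog h : 0 ≤ t generalizing t
  · have := this (-t) (by linarith)
    rwa [neg_sq, Real.cosh_neg] at this
  have h1 : t / 2 ≤ Real.sinh (t / 2) := Real.self_le_sinh_iff.2 (by linarith)
  have h2 := Real.cosh_sq (t / 2)
  have h3 := Real.cosh_two_mul (t / 2)
  rw [show 2 * (t / 2) = t by ring] at h3
  have : (t / 2) ^ 2 ≤ Real.sinh (t / 2) ^ 2 := pow_le_pow_left₀ (by linarith) h1 2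
  nlinarith

theorem kap_le (t : ℝ) (ht : t ^ 2 ≤ 2) : kap t ≤ 2 * t ^ 2 := by
  unfold kap
  have h1 := Real.cosh_le_exp_half_sq t
  have h2 := Real.abs_exp_sub_one_le (x := t ^ 2 / 2) (by rw [abs_of_nonneg (by positivity)]; linarith)
  rw [abs_of_nonneg (by positivity : 0 ≤ t ^ 2 / 2)] at h2
  have := le_abs_self (Real.exp (t ^ 2 / 2) - 1)
  linarith

theorem fac_exp (q : ℕ) : (q.factorial : ℝ) * Real.exp q ≤ ((q : ℝ) + 1) ^ (q + 1) := by
  induction q with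
  | zero => simp
  | succ q ih =>
    rw [Nat.factorial_succ]
    push_cast
    rw [Real.exp_add]
    have hq : (0:ℝ) < q + 1 := by positivity
    have hq2 : (0:ℝ) < (q:ℝ) + 2 := by positivity
    have h1 : Real.exp (1 / ((q:ℝ) + 2)) * (q + 1) ≤ q + 2 := by
      have := Real.add_one_le_exp (-(1 / ((q:ℝ) + 2)))
      rw [Real.exp_neg] at this
      have h2 := Real.exp_pos (1 / ((q:ℝ) + 2))
      have h3 : -(1 / ((q:ℝ) + 2)) + 1 = (q + 1) / (q + 2) := by field_simp; ring
      rw [h3, div_le_iff₀ hq2, ← div_eq_inv_mul, le_div_iff₀ h2] at this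
      linarith
    have h4 : Real.exp 1 * ((q:ℝ) + 1) ^ (q + 2) ≤ ((q:ℝ) + 2) ^ (q + 2) := by
      have : Real.exp 1 = Real.exp (1 / ((q:ℝ) + 2)) ^ (q + 2) := by
        rw [← Real.exp_nat_mul]; congr 1; push_cast; field_simp
      rw [this, ← mul_pow]
      apply pow_le_pow_left₀ (by positivity) h1
    calc ((q:ℝ) + 1) * q.factorial * (Real.exp q * Real.exp 1)
        = (q.factorial * Real.exp q) * (Real.exp 1 * (q + 1)) := by ring
      _ ≤ (q + 1) ^ (q + 1) * (Real.exp 1 * (q + 1)) := by gcongr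
      _ = Real.exp 1 * ((q:ℝ) + 1) ^ (q + 2) := by ring
      _ ≤ _ := h4
      _ = _ := by ring

theorem exists_q (δ : ℝ) (hδ : 0 < δ) (hδ2 : δ ≤ 2) : ∃ q : ℕ, 1 ≤ q ∧
    Real.exp (q * (2 - δ)) + 1 < (q:ℝ) ^ (2 * q) / (2 * q.factorial * (q + 1).factorial) := by
  have h := isLittleO_pow_exp_pos_mul_atTop 3 hδ
  have h2 := (h.def (c := 1 / (16 * Real.exp 2)) (by positivity))
  have h3 := (tendsto_natCast_atTop_atTop (R := ℝ)).eventually h2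
  obtain ⟨q, hq, hq1⟩ := (h3.and (eventually_ge_atTop 1)).exists
  refine ⟨q, hq1, ?_⟩
  obtain ⟨m, rfl⟩ : ∃ m, q = m + 1 := ⟨q - 1, by omega⟩
  have hf := fac_exp m
  set x : ℝ := ((m + 1 : ℕ) : ℝ) with hx
  have hx1 : 1 ≤ x := by rw [hx]; push_cast; linarith [(Nat.cast_nonneg m : (0:ℝ) ≤ m)]
  have hxm : x = m + 1 := by rw [hx]; push_cast; rfl
  rw [Real.norm_of_nonneg (by positivity), Real.norm_of_nonneg (by positivity)] at hq
  have e1 : Real.exp (x * (2 - δ)) + 1 ≤ 2 * Real.exp (x * (2 - δ)) := by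
    have : 1 ≤ Real.exp (x * (2 - δ)) := Real.one_le_exp (by nlinarith)
    linarith
  have hm : (m:ℝ) = x - 1 := by linarith
  have hfp := fac_pos m
  rw [lt_div_iff₀ (by have := fac_pos (m+1); have := fac_pos (m+1+1); positivity)]
  have hfac1 : ((m + 1).factorial : ℝ) = x * m.factorial := by
    rw [Nat.factorial_succ]; push_cast; rw [hxm]
  have hfac2 : ((m + 1 + 1).factorial : ℝ) = (x + 1) * (x * m.factorial) := by
    rw [Nat.factorial_succ, Nat.cast_mul, hfac1]; push_cast; rw [hxm]
  rw [hfac1, hfac2]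
  rw [← hxm] at hf
  have hE : 0 < Real.exp (x * (2 - δ)) := Real.exp_pos _
  have h7 : ((m.factorial : ℝ) * Real.exp m) ^ 2 ≤ x ^ (2 * (m + 1)) := by
    rw [mul_comm 2 (m+1), pow_mul]
    exact pow_le_pow_left₀ (by positivity) hf 2
  have h8 : Real.exp (m:ℝ) ^ 2 = Real.exp (x * (2 - δ)) * Real.exp (δ * x) / Real.exp 2 := by
    rw [← Real.exp_nat_mul, ← Real.exp_add, ← Real.exp_sub]
    congr 1; rw [hm]; push_cast; ring
  rw [div_mul_eq_mul_div, one_mul, le_div_iff₀ (by positivity)] at hq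
  have h9 : x ^ 3 * 16 ≤ Real.exp (δ * x) / Real.exp 2 := by
    rw [le_div_iff₀ (Real.exp_pos 2)]; linarith
  have h10 : Real.exp (x * (2 - δ)) * (x ^ 3 * 16) * m.factorial ^ 2 ≤ x ^ (2 * (m + 1)) := by
    refine le_trans ?_ h7
    rw [mul_pow, h8, mul_div_assoc]
    rw [mul_comm ((m.factorial:ℝ) ^ 2)]
    gcongr
  refine lt_of_lt_of_le ?_ h10
  have h11 : (Real.exp (x * (2 - δ)) + 1) * (2 * (x * m.factorial) * ((x + 1) * (x * m.factorial)))
     ≤ (2 * Real.exp (x * (2 - δ))) * (2 * (x * m.factorial) * ((x + 1) * (x * m.factorial))) := by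
    gcongr
  refine lt_of_le_of_lt h11 ?_
  have h12 : 0 < Real.exp (x * (2 - δ)) * m.factorial ^ 2 * x ^ 2 := by positivity
  nlinarith

end PG

namespace PG

theorem F_low (q n : ℕ) (hn1 : 1 ≤ n) (hn : 2 * q ^ 2 ≤ n) :
    (q:ℝ) ^ (2 * q) / (2 * q.factorial * (q + 1).factorial) ≤ F (q / Real.sqrt n) n := by
  refine le_trans ?_ (F_lower (q / Real.sqrt n) q n)
  have hn0 : (0:ℝ) < n := by exact_mod_cast hn1
  have hn2 : 2 * (q:ℝ) ^ 2 ≤ n := by exact_mod_cast hn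
  have h1 : ((q:ℝ) ^ 2 / n) ^ q ≤ kap (q / Real.sqrt n) ^ q := by
    apply pow_le_pow_left₀ (by positivity)
    have := kap_ge (q / Real.sqrt n)
    rwa [div_pow, Real.sq_sqrt hn0.le] at this
  have hqn : q ≤ n := by nlinarith
  have h2 : (n:ℝ) ^ q / 2 ≤ q.factorial * n.choose q := by
    have h3 := Nat.pow_sub_le_descFactorial n q
    rw [Nat.descFactorial_eq_factorial_mul_choose] at h3
    have h4 : (((n + 1 - q : ℕ) : ℝ)) ^ q ≤ q.factorial * n.choose q := by exact_mod_cast h3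
    refine le_trans ?_ h4
    have h5 : (n:ℝ) * (1 - q / n) ≤ ((n + 1 - q : ℕ) : ℝ) := by
      rw [Nat.cast_sub (by omega)]; push_cast; field_simp; linarith
    have hq1 : (q:ℝ) / n ≤ 1 := by rw [div_le_one hn0]; exact_mod_cast hqn
    have h6 := one_add_mul_le_pow (a := -((q:ℝ) / n)) (by linarith) q
    have h7 : (q:ℝ) * (q / n) ≤ 1 / 2 := by
      rw [← mul_div_assoc, div_le_iff₀ hn0]; nlinarith
    calc (n:ℝ) ^ q / 2 = n ^ q * (1 / 2) := by ring
      _ ≤ n ^ q * (1 + -((q:ℝ) / n)) ^ q := by gcongr; linarith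
      _ = (n * (1 - q / n)) ^ q := by rw [mul_pow]; ring
      _ ≤ _ := pow_le_pow_left₀ (mul_nonneg hn0.le (by linarith)) h5 q
  have hf1 := fac_pos q
  have hf2 := fac_pos (q + 1)
  calc (q:ℝ) ^ (2 * q) / (2 * q.factorial * (q + 1).factorial)
      = ((q:ℝ) ^ 2 / n) ^ q * (((n:ℝ) ^ q / 2) / q.factorial) / (q + 1).factorial := by
        rw [div_pow, ← pow_mul]; field_simp
    _ ≤ kap (q / Real.sqrt n) ^ q * (n.choose q) / (q + 1).factorial := by
        gcongr
        · exact pow_nonneg (kap_nonneg _) _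
        · rw [div_le_iff₀ hf1]; linarith

theorem F_up (q n : ℕ) (hn1 : 1 ≤ n) (hn : 2 * q ^ 2 ≤ n) :
    F (2 * (q / Real.sqrt n)) n ≤ Real.exp (16 * q ^ 2) := by
  refine (F_upper _ _).trans (Real.exp_le_exp.2 ?_)
  have hn0 : (0:ℝ) < n := by exact_mod_cast hn1
  have hn1' : (1:ℝ) ≤ n := by exact_mod_cast hn1
  have hn2 : 2 * (q:ℝ) ^ 2 ≤ n := by exact_mod_cast hn
  have e : (2 * (q / Real.sqrt n)) ^ 2 = 4 * (q:ℝ) ^ 2 / n := by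
    rw [mul_pow, div_pow, Real.sq_sqrt hn0.le]; ring
  have h := kap_le (2 * (q / Real.sqrt n)) (by rw [e, div_le_iff₀ hn0]; linarith)
  rw [e] at h
  calc kap (2 * (q / Real.sqrt n)) * (n + 1) ≤ (2 * (4 * (q:ℝ) ^ 2 / n)) * (n + n) := by gcongr
    _ = _ := by field_simp; ring

theorem edge (r : ℕ) (ε : ℝ) (hε : 0 < ε) (hε1 : ε ≤ 1) :
    ∀ᶠ n : ℕ in atTop, (2 - ε) * Real.sqrt n ≤ E n (fun ν => (ν.rowLen r : ℝ)) := by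
  obtain ⟨q, hq1, hq⟩ := exists_q (ε / 2) (by linarith) (by linarith)
  set C : ℝ := Real.exp (16 * q ^ 2) * (r + 4 / ε ^ 2) with hC
  have hlim : Tendsto (fun n : ℕ => C / Real.sqrt n) atTop (nhds 0) :=
    Tendsto.div_atTop tendsto_const_nhds (Real.tendsto_sqrt_atTop.comp tendsto_natCast_atTop_atTop)
  filter_upwards [hlim.eventually (gt_mem_nhds (show (0:ℝ) < 1 by norm_num)),
    eventually_ge_atTop 1, eventually_ge_atTop (2 * q ^ 2)] with n hn hn1 hnq
  by_contra hcon
  push Not at hcon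
  obtain ⟨n', rfl⟩ : ∃ m, n = m + 1 := ⟨n - 1, by omega⟩
  set m := E (n' + 1) (fun ν => (ν.rowLen r : ℝ)) with hm
  set s := Real.sqrt (n' + 1 : ℕ) with hs
  have hs0 : 0 < s := Real.sqrt_pos.2 (by positivity)
  have h1 := Q_le n' r ((2 - ε / 2) * s) m hm (by nlinarith)
  rw [← hs] at h1
  have h2 : s / ((2 - ε / 2) * s - m) ^ 2 ≤ 4 / ε ^ 2 / s := by
    have h3 : ε / 2 * s ≤ (2 - ε / 2) * s - m := by linarith
    calc s / ((2 - ε / 2) * s - m) ^ 2 ≤ s / (ε / 2 * s) ^ 2 := by gcongr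
      _ = _ := by field_simp; norm_num
  have h4 := F_le_Q (q / s) ((2 - ε / 2) * s) (by positivity) (n' + 1)
  have h5 := F_low q (n' + 1) hn1 hnq
  have h6 := F_up q (n' + 1) hn1 hnq
  rw [← hs] at h5 h6
  have h7 : Real.sqrt (F (2 * (q / s)) (n' + 1) * Q (n' + 1) ((2 - ε / 2) * s)) ≤ 1 := by
    rw [Real.sqrt_le_left (by norm_num), one_pow]
    calc _ ≤ Real.exp (16 * q ^ 2) * ((r + 4 / ε ^ 2) / s) := by
          apply mul_le_mul h6 _ (Q_nonneg _ _) (Real.exp_pos _).le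
          rw [add_div]; linarith
      _ = C / s := by rw [hC]; ring
      _ ≤ 1 := hn.le
  have h8 : q / s * ((2 - ε / 2) * s) = q * (2 - ε / 2) := by field_simp
  rw [h8] at h4
  linarith

end PG

namespace PG

noncomputable def pk (K n : ℕ) : ℝ := ∑ r ∈ Finset.range K, p r n

theorem pk_anti (K : ℕ) {m n : ℕ} (hm : 1 ≤ m) (h : m ≤ n) : pk K n ≤ pk K m := by
  induction n, h using Nat.le_induction with
  | base => exact le_rfl
  | succ n hn ih =>
    obtain ⟨j, rfl⟩ : ∃ j, n = j + 1 := ⟨n - 1, by omega⟩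
    exact (p_mono K j).trans ih

theorem p_le' (r n : ℕ) (hn : 1 ≤ n) : Real.sqrt n * p r n ≤ 1 := by
  obtain ⟨j, rfl⟩ : ∃ j, n = j + 1 := ⟨n - 1, by omega⟩
  have := p_le r j
  have hs : 0 < Real.sqrt (j + 1 : ℕ) := Real.sqrt_pos.2 (by positivity)
  rw [le_div_iff₀ hs] at this
  linarith

theorem sum_inv_sqrt (n : ℕ) : ∑ m ∈ Finset.range n, 1 / Real.sqrt (m + 1 : ℕ) ≤ 2 * Real.sqrt n := by
  induction n with
  | zero => simp
  | succ n ih =>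
    rw [Finset.sum_range_succ]
    have ha : 0 ≤ Real.sqrt n := Real.sqrt_nonneg _
    have hb : 0 < Real.sqrt (n + 1 : ℕ) := Real.sqrt_pos.2 (by positivity)
    have ha2 := Real.sq_sqrt (show (0:ℝ) ≤ n by positivity)
    have hb2 := Real.sq_sqrt (show (0:ℝ) ≤ (n + 1 : ℕ) by positivity)
    have : 1 / Real.sqrt (n + 1 : ℕ) ≤ 2 * Real.sqrt (n + 1 : ℕ) - 2 * Real.sqrt n := by
      rw [div_le_iff₀ hb]
      push_cast at hb2 ⊢
      push_cast at hb
      nlinarith [sq_nonneg (Real.sqrt ((n:ℝ) + 1) - Real.sqrt n)]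
    linarith

theorem SK_eq (K n : ℕ) : ∑ m ∈ Finset.range n, pk K (m + 1) =
    ∑ r ∈ Finset.range K, E n (fun ν => (ν.rowLen r : ℝ)) := by
  unfold pk
  rw [Finset.sum_comm]
  simp only [E_rowLen]

theorem SK_le (K n : ℕ) : ∑ m ∈ Finset.range n, pk K (m + 1) ≤ K * (2 * Real.sqrt n) := by
  calc _ ≤ ∑ m ∈ Finset.range n, K * (1 / Real.sqrt (m + 1 : ℕ)) := by
        apply Finset.sum_le_sum
        intro m _
        unfold pk
        calc _ ≤ ∑ r ∈ Finset.range K, 1 / Real.sqrt (m + 1 : ℕ) :=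
              Finset.sum_le_sum (fun r _ => p_le r m)
          _ = _ := by simp
    _ = K * ∑ m ∈ Finset.range n, (1 / Real.sqrt (m + 1 : ℕ)) := by rw [Finset.mul_sum]
    _ ≤ _ := by gcongr; exact sum_inv_sqrt n

theorem pk_lower (K : ℕ) (η : ℝ) (hη : 0 < η) (hη1 : η ≤ 1 / 2) :
    ∀ᶠ n : ℕ in atTop, K * (1 - η) ≤ Real.sqrt n * pk K n := by
  have h1 : ∀ᶠ n : ℕ in atTop, ∀ r ∈ Finset.range K,
      (2 - η ^ 2 / 4) * Real.sqrt n ≤ E n (fun ν => (ν.rowLen r : ℝ)) := by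
    rw [Filter.eventually_all_finset]
    intro r _
    exact edge r _ (by positivity) (by nlinarith)
  obtain ⟨N, hN⟩ := eventually_atTop.1 h1
  filter_upwards [eventually_ge_atTop N, eventually_ge_atTop 1, eventually_ge_atTop ⌈1 / η⌉₊]
    with n hnN hn1 hnη
  have hnη' : 1 / η ≤ n := (Nat.le_ceil _).trans (by exact_mod_cast hnη)
  rw [div_le_iff₀ hη] at hnη'
  have hn0 : (0:ℝ) < n := by exact_mod_cast hn1
  set h := ⌈η * n⌉₊ with hh
  have hh1 : η * n ≤ h := Nat.le_ceil _
  have hh2 : (h:ℝ) < η * n + 1 := Nat.ceil_lt_add_one (by positivity)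
  have hS : ∑ m ∈ Finset.range (n + h), pk K (m + 1) ≤ K * (2 * Real.sqrt n) + h * pk K n := by
    rw [Finset.sum_range_add]
    apply add_le_add (SK_le K n)
    calc _ ≤ ∑ x ∈ Finset.range h, pk K n :=
          Finset.sum_le_sum (fun x _ => pk_anti K hn1 (by omega))
      _ = _ := by simp
  have hL : K * ((2 - η ^ 2 / 4) * Real.sqrt (n + h : ℕ)) ≤ ∑ m ∈ Finset.range (n + h), pk K (m + 1) := by
    rw [SK_eq]
    calc _ = ∑ r ∈ Finset.range K, ((2 - η ^ 2 / 4) * Real.sqrt (n + h : ℕ)) := by simp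
      _ ≤ _ := Finset.sum_le_sum (fun r hr => hN (n + h) (by omega) r hr)
  set x : ℝ := h / n with hx
  have hx1 : η ≤ x := by rw [hx, le_div_iff₀ hn0]; exact hh1
  have hx2 : x ≤ 2 * η := by rw [hx, div_le_iff₀ hn0]; linarith
  have hhx : (h:ℝ) = n * x := by rw [hx]; field_simp
  set s := Real.sqrt n with hs
  have hs0 : 0 < s := Real.sqrt_pos.2 hn0
  have hss : s * s = n := Real.mul_self_sqrt hn0.le
  have hsq : Real.sqrt (n + h : ℕ) = s * Real.sqrt (1 + x) := by
    push_cast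
    rw [hhx, show (n:ℝ) + n * x = n * (1 + x) by ring, Real.sqrt_mul hn0.le]
  have hy1 : 1 + x / 2 - x ^ 2 / 8 ≤ Real.sqrt (1 + x) := by
    apply Real.le_sqrt_of_sq_le
    nlinarith [mul_nonneg (show 0 ≤ x by linarith) (sq_nonneg x), mul_nonneg (sq_nonneg x) (sq_nonneg x),
      mul_nonneg (mul_nonneg (show 0 ≤ x by linarith) (sq_nonneg x)) (show 0 ≤ 1 - x by linarith)]
  have hy2 : Real.sqrt (1 + x) ≤ 2 := by
    rw [Real.sqrt_le_left (by norm_num)]; linarith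
  rw [hsq] at hL
  have hK : (0:ℝ) ≤ K := by positivity
  have hmain := hL.trans hS
  -- K * ((2 - η²/4) s y) ≤ K * 2 s + n x pk
  rw [hhx, ← hss] at hmain
  have hx0 : 0 < x := by linarith
  have e1 : x * (1 - η) ≤ (2 - η ^ 2 / 4) * Real.sqrt (1 + x) - 2 := by
    have : η ^ 2 / 4 * Real.sqrt (1 + x) ≤ η ^ 2 / 4 * 2 := by gcongr
    nlinarith
  have e2 : K * (x * (1 - η)) * s ≤ (s * pk K n * x) * s := by
    have := mul_le_mul_of_nonneg_left e1 (mul_nonneg hK hs0.le)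
    nlinarith
  have e3 := le_of_mul_le_mul_right e2 hs0
  have e4 : (K * (1 - η)) * x ≤ (s * pk K n) * x := by linarith
  exact le_of_mul_le_mul_right e4 hx0

theorem p_lim (r : ℕ) : Tendsto (fun n : ℕ => Real.sqrt n * p r n) atTop (nhds 1) := by
  rw [Metric.tendsto_atTop]
  intro ε hε
  set η := min (1 / 2) (ε / (2 * (r + 1))) with hη
  have hη0 : 0 < η := by rw [hη]; positivity
  obtain ⟨N, hN⟩ := eventually_atTop.1 (pk_lower (r + 1) η hη0 (min_le_left _ _))
  refine ⟨max N 1, fun n hn => ?_⟩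
  have h1 := hN n (le_trans (le_max_left _ _) hn)
  have hn1 : 1 ≤ n := le_trans (le_max_right _ _) hn
  have h2 := p_le' r n hn1
  unfold pk at h1
  rw [Finset.sum_range_succ, mul_add, Finset.mul_sum] at h1
  have h3 : ∑ i ∈ Finset.range r, Real.sqrt n * p i n ≤ r := by
    calc _ ≤ ∑ i ∈ Finset.range r, (1:ℝ) := Finset.sum_le_sum (fun i _ => p_le' i n hn1)
      _ = _ := by simp
  have h4 : η * (r + 1) ≤ ε / 2 := by
    calc η * (r + 1) ≤ (ε / (2 * (r + 1))) * (r + 1) := by gcongr; exact min_le_right _ _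
      _ = _ := by field_simp
  push_cast at h1
  rw [Real.dist_eq, abs_lt]
  constructor <;> nlinarith

end PG

namespace PG

theorem tv_one (n r : ℕ) (hn : 1 ≤ n) :
    ∑ ν ∈ Y n, |d ν * g r ν / n.factorial - p r n * (d ν ^ 2 / n.factorial)| ≤
      Real.sqrt (1 - (Real.sqrt n * p r n) ^ 2) / Real.sqrt n := by
  obtain ⟨m, rfl⟩ : ∃ j, n = j + 1 := ⟨n - 1, by omega⟩
  have hf := fac_pos (m + 1)
  have hfm := fac_pos m
  have hn0 : (0:ℝ) < (m + 1 : ℕ) := by positivity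
  set P := p r (m + 1) with hP
  have hg := sum_g_sq m r
  have hd := sum_sq (m + 1)
  have hp : ∑ ν ∈ Y (m + 1), d ν * g r ν = P * (m + 1).factorial := by
    rw [hP, p, div_mul_cancel₀ _ (fac_ne _)]
  have hfac : ((m + 1).factorial : ℝ) = (m + 1 : ℕ) * m.factorial := by
    rw [Nat.factorial_succ]; push_cast; rfl
  have h1 : ∑ ν ∈ Y (m + 1), |d ν * g r ν / (m + 1).factorial - P * (d ν ^ 2 / (m + 1).factorial)| =
     (∑ ν ∈ Y (m + 1), d ν * |g r ν - P * d ν|) / (m + 1).factorial := by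
    rw [Finset.sum_div]
    apply Finset.sum_congr rfl
    intro ν _
    rw [show d ν * g r ν / (m + 1).factorial - P * (d ν ^ 2 / (m + 1).factorial) =
      d ν * (g r ν - P * d ν) / (m + 1).factorial by ring, abs_div, abs_mul,
      abs_of_nonneg (d_nonneg ν), abs_of_pos hf]
  rw [h1, le_div_iff₀ (Real.sqrt_pos.2 hn0)]
  apply Real.le_sqrt_of_sq_le
  rw [mul_pow, mul_pow, Real.sq_sqrt hn0.le, div_pow]
  have h2 := Finset.sum_mul_sq_le_sq_mul_sq (Y (m + 1)) d (fun ν => |g r ν - P * d ν|)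
  simp only [sq_abs] at h2
  have h3 : ∑ ν ∈ Y (m + 1), (g r ν - P * d ν) ^ 2 =
     ∑ ν ∈ Y (m + 1), g r ν ^ 2 - 2 * P * ∑ ν ∈ Y (m + 1), d ν * g r ν +
      P ^ 2 * ∑ ν ∈ Y (m + 1), d ν ^ 2 := by
    rw [Finset.mul_sum, Finset.mul_sum, ← Finset.sum_sub_distrib, ← Finset.sum_add_distrib]
    apply Finset.sum_congr rfl
    intros; ring
  rw [h3, hp, hd] at h2
  have h4 : (∑ ν ∈ Y (m + 1), d ν * |g r ν - P * d ν|) ^ 2 ≤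
      (m + 1).factorial * (m.factorial - P ^ 2 * (m + 1).factorial) := by
    refine h2.trans (mul_le_mul_of_nonneg_left ?_ hf.le)
    linarith
  rw [div_mul_eq_mul_div, div_le_iff₀ (by positivity)]
  calc _ ≤ ((m + 1).factorial * (m.factorial - P ^ 2 * (m + 1).factorial)) * ((m + 1 : ℕ) : ℝ) := by gcongr
    _ = _ := by
      rw [hfac]; ring

noncomputable def cc (k n : ℕ) : ℝ :=
  ∑ r ∈ Finset.range (k + 1), Real.sqrt (1 - (Real.sqrt n * p r n) ^ 2) / Real.sqrt n

theorem cc_o (k : ℕ) : (cc k) =o[atTop] fun n : ℕ => 1 / Real.sqrt n := by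
  unfold cc
  apply Asymptotics.IsLittleO.fun_sum
  intro r _
  have h : Tendsto (fun n : ℕ => Real.sqrt (1 - (Real.sqrt n * p r n) ^ 2)) atTop (nhds 0) := by
    have h1 := p_lim r
    have h2 : Tendsto (fun n : ℕ => Real.sqrt (1 - (Real.sqrt n * p r n) ^ 2)) atTop
      (nhds (Real.sqrt (1 - 1 ^ 2))) := ((h1.pow 2).const_sub 1).sqrt
    simpa using h2
  have h3 := (Asymptotics.isLittleO_one_iff ℝ).2 h
  have h4 := h3.mul_isBigO (Asymptotics.isBigO_refl (fun n : ℕ => 1 / Real.sqrt n) atTop)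
  simpa [div_eq_mul_inv] using h4

end PG

namespace PG

instance : Countable YoungDiagram := by
  apply Function.Injective.countable (f := fun μ : YoungDiagram => μ.cells)
  intro a b h
  exact YoungDiagram.ext h

def Step (μ ν : YoungDiagram) : Prop := ∃ r ∈ A μ, ν = add μ r

theorem Step.card {μ ν : YoungDiagram} (h : Step μ ν) : ν.card = μ.card + 1 := by
  obtain ⟨r, hr, rfl⟩ := h
  exact card_add (mem_A.1 hr)

theorem Step.le {μ ν : YoungDiagram} (h : Step μ ν) : μ ≤ ν := by
  obtain ⟨r, hr, rfl⟩ := h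
  rw [← YoungDiagram.cells_subset_iff]
  rintro ⟨i, j⟩ hij
  rw [YoungDiagram.mem_cells, YoungDiagram.mem_iff_lt_rowLen] at hij ⊢
  rw [rl_add (mem_A.1 hr)]
  omega

theorem add_inj {μ : YoungDiagram} {a b : ℕ} (ha : a ∈ A μ) (hb : b ∈ A μ)
    (h : add μ a = add μ b) : a = b := by
  by_contra hab
  have h1 := rl_add (mem_A.1 ha) a
  rw [h, rl_add (mem_A.1 hb), if_neg hab, if_pos rfl] at h1
  omega

theorem sum_A_d' (μ : YoungDiagram) : ∑ b ∈ A μ, d (add μ b) = (μ.card + 1) * d μ := Dn_d μ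

section
variable {Ω : Type*} [MeasurableSpace Ω] {P : Measure Ω} {lam : ℕ → Ω → YoungDiagram}

def atom (lam : ℕ → Ω → YoungDiagram) (m : ℕ) (π : ℕ → YoungDiagram) : Set Ω :=
  {ω | ∀ i ≤ m, lam i ω = π i}

def Valid (m : ℕ) (π : ℕ → YoungDiagram) : Prop := π 0 = ⊥ ∧ ∀ i < m, Step (π i) (π (i + 1))

theorem Valid.card {m : ℕ} {π : ℕ → YoungDiagram} (h : Valid m π) : ∀ i ≤ m, (π i).card = i := by
  intro i
  induction i with
  | zero => intro _; rw [h.1]; rfl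
  | succ i ih => intro hi; rw [(h.2 i hi).card, ih (by omega)]

theorem meas_atom (h : IsPlancherelGrowthProcess P lam) (m : ℕ) (π : ℕ → YoungDiagram) :
    MeasurableSet (atom lam m π) := by
  have : atom lam m π = ⋂ i ∈ Finset.range (m + 1), {ω | lam i ω = π i} := by
    ext ω
    simp only [atom, Set.mem_ofPred_eq, Set.mem_iInter, Finset.mem_range, Nat.lt_succ_iff]
  rw [this]
  exact Finset.measurableSet_biInter _ (fun i _ => h.2.1 i _)

theorem P_atom (h : IsPlancherelGrowthProcess P lam) {m : ℕ} {π : ℕ → YoungDiagram} (hv : Valid m π) :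
    P (atom lam m π) = ENNReal.ofReal (d (π m) / m.factorial) := by
  have := h.2.2 m π hv.1 (fun i hi => ⟨(hv.2 i hi).le, (hv.2 i hi).card⟩)
  rw [atom, this, ENNReal.ofReal_div_of_pos (fac_pos m), d, ENNReal.ofReal_natCast,
    ENNReal.ofReal_natCast]

theorem valid_ext {m : ℕ} {π : ℕ → YoungDiagram} (hv : Valid m π) {ν : YoungDiagram}
    (hs : Step (π m) ν) : Valid (m + 1) (Function.update π (m + 1) ν) := by
  constructor
  · rw [Function.update_of_ne (by omega)]; exact hv.1
  · intro i hi
    rw [Function.update_of_ne (by omega)]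
    rcases Nat.lt_succ_iff_lt_or_eq.1 hi with h1 | h1
    · rw [Function.update_of_ne (by omega)]; exact hv.2 i h1
    · subst h1; rw [Function.update_self]; exact hs

theorem atom_ext (m : ℕ) (π : ℕ → YoungDiagram) (ν : YoungDiagram) :
    atom lam (m + 1) (Function.update π (m + 1) ν) = atom lam m π ∩ {ω | lam (m + 1) ω = ν} := by
  ext ω
  simp only [atom, Set.mem_ofPred_eq, Set.mem_inter_iff]
  constructor
  · intro h
    refine ⟨fun i hi => ?_, ?_⟩
    · rw [h i (by omega), Function.update_of_ne (by omega)]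
    · rw [h (m + 1) le_rfl, Function.update_self]
  · rintro ⟨h1, h2⟩ i hi
    rcases Nat.le_succ_iff.1 hi with h3 | h3
    · rw [Function.update_of_ne (by omega)]; exact h1 i h3
    · subst h3; rw [Function.update_self]; exact h2

theorem atom_nostep (h : IsPlancherelGrowthProcess P lam) {m : ℕ} {π : ℕ → YoungDiagram}
    (hv : Valid m π) : P (atom lam m π ∩ {ω | ¬ Step (lam m ω) (lam (m + 1) ω)}) = 0 := by
  classical
  haveI := h.1
  set U := ⋃ b ∈ A (π m), atom lam (m + 1) (Function.update π (m + 1) (add (π m) b)) with hU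
  have hsub : U ⊆ atom lam m π := by
    rw [hU]
    refine Set.iUnion₂_subset fun b _ => ?_
    rw [atom_ext]
    exact Set.inter_subset_left
  have hUm : MeasurableSet U := Finset.measurableSet_biUnion _ (fun b _ => meas_atom h _ _)
  have hPU : P U = P (atom lam m π) := by
    rw [hU, measure_biUnion_finset]
    · rw [P_atom h hv, Finset.sum_congr rfl (fun b hb => P_atom h (valid_ext hv ⟨b, hb, rfl⟩)),
        ← ENNReal.ofReal_sum_of_nonneg (fun b _ => div_nonneg (d_nonneg _) (fac_pos _).le)]
      congr 1
      simp only [Function.update_self]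
      rw [← Finset.sum_div, sum_A_d', hv.card m le_rfl, Nat.factorial_succ]
      have := fac_ne m
      push_cast
      field_simp
    · intro a ha b hb hab
      rw [Function.onFun, Set.disjoint_left]
      intro ω h1 h2
      rw [atom_ext] at h1 h2
      exact hab (add_inj ha hb (h1.2.symm.trans h2.2))
    · intro b _; exact meas_atom h _ _
  have hd : P (atom lam m π \ U) = 0 := by
    rw [measure_sdiff hsub hUm.nullMeasurableSet (measure_ne_top _ _), hPU, tsub_self]
  refine measure_mono_null ?_ hd
  rintro ω ⟨h1, h2⟩
  refine ⟨h1, fun h3 => h2 ?_⟩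
  rw [hU] at h3
  simp only [Set.mem_iUnion] at h3
  obtain ⟨b, hb, h4⟩ := h3
  rw [atom_ext] at h4
  have e1 : lam m ω = π m := h1 m le_rfl
  refine ⟨b, by rw [e1]; exact hb, ?_⟩
  rw [e1]; exact h4.2

def ext' {m : ℕ} (x : Fin (m + 1) → YoungDiagram) (i : ℕ) : YoungDiagram :=
  if h : i < m + 1 then x ⟨i, h⟩ else ⊥

theorem atom_fin (m : ℕ) (x : Fin (m + 1) → YoungDiagram) :
    atom lam m (ext' x) = {ω | (fun i : Fin (m + 1) => lam i ω) = x} := by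
  ext ω
  simp only [atom, Set.mem_ofPred_eq, funext_iff, ext']
  constructor
  · intro h i
    have := h i (by omega)
    rw [this, dif_pos i.2]
  · intro h i hi
    rw [dif_pos (by omega)]
    exact h ⟨i, by omega⟩

theorem ae_valid (h : IsPlancherelGrowthProcess P lam) (m : ℕ) :
    ∀ᵐ ω ∂P, Valid m (fun i => lam i ω) := by
  haveI := h.1
  induction m with
  | zero =>
    have h1 := P_atom h (m := 0) (π := fun _ => ⊥) ⟨rfl, by intro i hi; omega⟩
    have h2 : P (atom lam 0 fun _ => ⊥)ᶜ = 0 := by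
      rw [prob_compl_eq_zero_iff (meas_atom h _ _), h1, d_bot]; simp
    filter_upwards [measure_eq_zero_iff_ae_notMem.1 h2] with ω hω
    rw [Set.notMem_compl_iff] at hω
    exact ⟨hω 0 le_rfl, by intro i hi; omega⟩
  | succ m ih =>
    have h1 : ∀ᵐ ω ∂P, ∀ x : Fin (m + 1) → YoungDiagram, Valid m (ext' x) →
        ω ∉ atom lam m (ext' x) ∩ {ω | ¬ Step (lam m ω) (lam (m + 1) ω)} := by
      rw [ae_all_iff]
      intro x
      by_cases hx : Valid m (ext' x)
      · filter_upwards [measure_eq_zero_iff_ae_notMem.1 (atom_nostep h hx)] with ω hω _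
        exact hω
      · exact Eventually.of_forall fun ω hh => absurd hh hx
    filter_upwards [ih, h1] with ω hω h2
    refine ⟨hω.1, fun i hi => ?_⟩
    rcases Nat.lt_succ_iff_lt_or_eq.1 hi with h3 | h3
    · exact hω.2 i h3
    · subst h3
      have hmem : ω ∈ atom lam i (ext' fun j : Fin (i + 1) => lam j ω) := by
        rw [atom_fin]; rfl
      have hval : Valid i (ext' fun j : Fin (i + 1) => lam j ω) := by
        constructor
        · rw [← hmem 0 (by omega)]; exact hω.1
        · intro j hj
          rw [← hmem j (by omega), ← hmem (j + 1) (by omega)]; exact hω.2 j hj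
      have := h2 _ hval
      by_contra hcon
      exact this ⟨hmem, hcon⟩

theorem ae_step (h : IsPlancherelGrowthProcess P lam) :
    ∀ᵐ ω ∂P, ∀ m, Step (lam m ω) (lam (m + 1) ω) := by
  rw [ae_all_iff]
  intro m
  filter_upwards [ae_valid h (m + 1)] with ω hω
  exact hω.2 m (by omega)

theorem ae_card (h : IsPlancherelGrowthProcess P lam) :
    ∀ᵐ ω ∂P, ∀ m, lam m ω ∈ Y m := by
  rw [ae_all_iff]
  intro m
  filter_upwards [ae_valid h m] with ω hω
  exact mem_Y.2 (hω.card m le_rfl)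

open Classical in
noncomputable def TT (m : ℕ) (ν ν' : YoungDiagram) : ENNReal :=
  if Step ν ν' then ENNReal.ofReal (d ν' / ((m + 1) * d ν)) else 0

theorem markov_atom (h : IsPlancherelGrowthProcess P lam) (m : ℕ) (π : ℕ → YoungDiagram)
    (ν' : YoungDiagram) : P (atom lam m π ∩ {ω | lam (m + 1) ω = ν'}) =
      P (atom lam m π) * TT m (π m) ν' := by
  by_cases hv : Valid m π
  · unfold TT
    split_ifs with hs
    · rw [← atom_ext, P_atom h (valid_ext hv hs), P_atom h hv, Function.update_self,
        ← ENNReal.ofReal_mul (div_nonneg (d_nonneg _) (fac_pos _).le), Nat.factorial_succ]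
      congr 1
      have := fac_ne m
      have hd := (d_pos (π m)).ne'
      push_cast
      field_simp
    · rw [mul_zero]
      refine measure_mono_null ?_ (atom_nostep h hv)
      rintro ω ⟨h1, h2⟩
      refine ⟨h1, ?_⟩
      have e1 : lam m ω = π m := h1 m le_rfl
      have e2 : lam (m + 1) ω = ν' := h2
      show ¬ Step (lam m ω) (lam (m + 1) ω)
      rw [e1, e2]; exact hs
  · have h0 : P (atom lam m π) = 0 := by
      rw [measure_eq_zero_iff_ae_notMem]
      filter_upwards [ae_valid h m] with ω hω hmem
      apply hv
      constructor
      · rw [← hmem 0 (by omega)]; exact hω.1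
      · intro j hj
        rw [← hmem j (by omega), ← hmem (j + 1) (by omega)]; exact hω.2 j hj
    rw [h0, zero_mul]
    exact measure_mono_null Set.inter_subset_left h0

end
end PG

namespace PG

section
variable {Ω : Type*} [MeasurableSpace Ω] {P : Measure Ω} {lam : ℕ → Ω → YoungDiagram}

theorem meas_fib {X : Type*} [Countable X] {f : Ω → X} (hf : ∀ x, MeasurableSet {ω | f ω = x})
    (Q : X → Prop) : MeasurableSet {ω | Q (f ω)} := by
  have : {ω | Q (f ω)} = ⋃ x ∈ {x | Q x}, {ω | f ω = x} := by
    ext ω; simp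
  rw [this]
  exact MeasurableSet.biUnion (Set.to_countable _) (fun x _ => hf x)

theorem tot {X : Type*} [Countable X] {f : Ω → X} (hf : ∀ x, MeasurableSet {ω | f ω = x})
    {B : Set Ω} (hB : MeasurableSet B) : P B = ∑' x, P (B ∩ {ω | f ω = x}) := by
  have : B = ⋃ x, B ∩ {ω | f ω = x} := by
    ext ω; simp
  conv_lhs => rw [this]
  apply measure_iUnion
  · intro x y hxy
    rw [Function.onFun, Set.disjoint_left]
    rintro ω ⟨_, h1⟩ ⟨_, h2⟩
    exact hxy (h1.symm.trans h2)
  · intro x; exact hB.inter (hf x)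

def pth (lam : ℕ → Ω → YoungDiagram) (m : ℕ) (ω : Ω) : Fin (m + 1) → YoungDiagram := fun i => lam i ω

theorem pth_fib (h : IsPlancherelGrowthProcess P lam) (m : ℕ) (x : Fin (m + 1) → YoungDiagram) :
    MeasurableSet {ω | pth lam m ω = x} := by
  have := meas_atom h m (ext' x)
  rw [atom_fin] at this
  exact this

theorem meas_two (h : IsPlancherelGrowthProcess P lam) (m : ℕ) (B : YoungDiagram → YoungDiagram → Prop) :
    MeasurableSet {ω | B (lam m ω) (lam (m + 1) ω)} :=
  meas_fib (pth_fib h (m + 1)) (fun x => B (x ⟨m, by omega⟩) (x ⟨m + 1, by omega⟩))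

theorem markov_past (h : IsPlancherelGrowthProcess P lam) (m : ℕ)
    (S' : (Fin (m + 1) → YoungDiagram) → Prop) (ν ν' : YoungDiagram) :
    P ({ω | S' (pth lam m ω)} ∩ {ω | lam m ω = ν} ∩ {ω | lam (m + 1) ω = ν'}) =
      P ({ω | S' (pth lam m ω)} ∩ {ω | lam m ω = ν}) * TT m ν ν' := by
  have hA : MeasurableSet ({ω | S' (pth lam m ω)} ∩ {ω | lam m ω = ν}) :=
    (meas_fib (pth_fib h m) S').inter (h.2.1 m ν)
  rw [tot (pth_fib h m) (hA.inter (h.2.1 (m + 1) ν')), tot (pth_fib h m) hA, ← ENNReal.tsum_mul_right]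
  congr 1
  funext x
  by_cases hx : S' x ∧ x (Fin.last m) = ν
  · have e : {ω | S' (pth lam m ω)} ∩ {ω | lam m ω = ν} ∩ {ω | pth lam m ω = x} =
      atom lam m (ext' x) := by
      rw [atom_fin]
      ext ω
      constructor
      · rintro ⟨_, h2⟩; exact h2
      · intro h2
        have h2' : pth lam m ω = x := h2
        refine ⟨⟨?_, ?_⟩, h2⟩
        · show S' _; rw [h2']; exact hx.1
        · show lam m ω = ν
          rw [← hx.2, ← h2']; rfl
    rw [Set.inter_right_comm, e, markov_atom h]
    congr 2
    rw [← hx.2]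
    unfold ext'
    rw [dif_pos (by omega)]; rfl
  · have e : {ω | S' (pth lam m ω)} ∩ {ω | lam m ω = ν} ∩ {ω | pth lam m ω = x} = ∅ := by
      rw [Set.eq_empty_iff_forall_notMem]
      rintro ω ⟨⟨h1, h2⟩, h3⟩
      apply hx
      have h3' : pth lam m ω = x := h3
      have h1' : S' (pth lam m ω) := h1
      rw [h3'] at h1'
      refine ⟨h1', ?_⟩
      rw [← h3']; exact h2
    rw [Set.inter_right_comm, e]; simp

def Fut (lam : ℕ → Ω → YoungDiagram) (B : ℕ → YoungDiagram → YoungDiagram → Prop) (y : YoungDiagram)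
    (L m : ℕ) : Set Ω :=
  {ω | (∀ j, m ≤ j → j < L → B j (lam j ω) (lam (j + 1) ω)) ∧ lam L ω = y}

theorem meas_Fut (h : IsPlancherelGrowthProcess P lam) (B y L m) : MeasurableSet (Fut lam B y L m) := by
  have : Fut lam B y L m = (⋂ j, {ω | m ≤ j → j < L → B j (lam j ω) (lam (j + 1) ω)}) ∩
    {ω | lam L ω = y} := by
    ext ω; simp [Fut]
  rw [this]
  exact (MeasurableSet.iInter fun j => meas_two h j (fun a b => m ≤ j → j < L → B j a b)).inter (h.2.1 _ _)

theorem markov_fut (h : IsPlancherelGrowthProcess P lam) (B : ℕ → YoungDiagram → YoungDiagram → Prop)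
    (y : YoungDiagram) (t : ℕ) : ∀ m : ℕ, ∃ G : YoungDiagram → ENNReal,
      ∀ (S' : (Fin (m + 1) → YoungDiagram) → Prop) (ν : YoungDiagram),
      P ({ω | S' (pth lam m ω)} ∩ {ω | lam m ω = ν} ∩ Fut lam B y (m + t) m) =
      P ({ω | S' (pth lam m ω)} ∩ {ω | lam m ω = ν}) * G ν := by
  classical
  induction t with
  | zero =>
    intro m
    refine ⟨fun ν => if ν = y then 1 else 0, fun S' ν => ?_⟩
    beta_reduce
    split_ifs with hν
    · subst hν
      rw [mul_one]
      congr 1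
      rw [Set.inter_eq_left]
      rintro ω ⟨_, h2⟩
      exact ⟨fun j h3 h4 => by omega, h2⟩
    · rw [mul_zero]
      convert measure_empty (μ := P)
      rw [Set.eq_empty_iff_forall_notMem]
      rintro ω ⟨⟨_, h2⟩, ⟨_, h3⟩⟩
      exact hν (h2.symm.trans h3)
  | succ t ih =>
    intro m
    obtain ⟨G, hG⟩ := ih (m + 1)
    refine ⟨fun ν => ∑' ν', TT m ν ν' * (if B m ν ν' then G ν' else 0), fun S' ν => ?_⟩
    have hA : MeasurableSet ({ω | S' (pth lam m ω)} ∩ {ω | lam m ω = ν}) :=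
      (meas_fib (pth_fib h m) S').inter (h.2.1 m ν)
    rw [tot (h.2.1 (m + 1)) (hA.inter (meas_Fut h _ _ _ _)), ← ENNReal.tsum_mul_left]
    congr 1
    funext ν'
    split_ifs with hB
    · rw [← mul_assoc, ← markov_past h]
      have := hG (fun x => S' (fun i => x i.castSucc) ∧ x ⟨m, by omega⟩ = ν) ν'
      have e : {ω | S' (fun i => pth lam (m + 1) ω i.castSucc) ∧ pth lam (m + 1) ω ⟨m, by omega⟩ = ν} =
        {ω | S' (pth lam m ω)} ∩ {ω | lam m ω = ν} := rfl
      rw [e] at this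
      rw [← this]
      congr 1
      ext ω
      constructor
      · rintro ⟨⟨h1, h2⟩, h3⟩
        refine ⟨⟨h1, h3⟩, fun j h4 h5 => h2.1 j (by omega) (by omega), ?_⟩
        rw [← h2.2]; congr 1; omega
      · rintro ⟨⟨h1, h3⟩, h2⟩
        refine ⟨⟨h1, fun j h4 h5 => ?_, ?_⟩, h3⟩
        · rcases h4.lt_or_eq with h6 | h6
          · exact h2.1 j (by omega) (by omega)
          · subst h6
            have e1 : lam m ω = ν := h1.2
            have e2 : lam (m + 1) ω = ν' := h3
            rw [e1, e2]; exact hB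
        · rw [← h2.2]; congr 1; omega
    · rw [mul_zero, mul_zero]
      convert measure_empty (μ := P)
      rw [Set.eq_empty_iff_forall_notMem]
      rintro ω ⟨⟨⟨_, h1⟩, h2⟩, h3⟩
      have := h2.1 m le_rfl (by omega)
      have e1 : lam m ω = ν := h1
      have e2 : lam (m + 1) ω = ν' := h3
      rw [e1, e2] at this
      exact hB this

theorem step_iff_rem {μ ν : YoungDiagram} : Step μ ν ↔ ∃ r ∈ R ν, μ = rem ν r := by
  constructor
  · rintro ⟨r, hr, rfl⟩
    exact ⟨r, mem_R.2 (removable_add (mem_A.1 hr)), (rem_add (mem_A.1 hr)).symm⟩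
  · rintro ⟨r, hr, rfl⟩
    exact ⟨r, mem_A.2 (addable_rem (mem_R.1 hr)), (add_rem (mem_R.1 hr)).symm⟩

theorem rem_inj {μ : YoungDiagram} {a b : ℕ} (ha : a ∈ R μ) (hb : b ∈ R μ)
    (h : rem μ a = rem μ b) : a = b := by
  by_contra hab
  have h1 := rl_rem (mem_R.1 ha) a
  rw [h, rl_rem (mem_R.1 hb), if_neg hab, if_pos rfl] at h1
  have := mem_R.1 ha
  unfold Removable at this
  omega

theorem P_joint (h : IsPlancherelGrowthProcess P lam) (m : ℕ) (μ ν : YoungDiagram) :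
    P ({ω | lam m ω = μ} ∩ {ω | lam (m + 1) ω = ν}) = P {ω | lam m ω = μ} * TT m μ ν := by
  have := markov_past h m (fun _ => True) μ ν
  simpa using this

theorem P_marg_joint (h : IsPlancherelGrowthProcess P lam) (m : ℕ) :
    (∀ ν ∈ Y m, P {ω | lam m ω = ν} = ENNReal.ofReal (d ν ^ 2 / m.factorial)) ∧
    (∀ ν ∈ Y (m + 1), ∀ a ∈ R ν, P ({ω | lam m ω = rem ν a} ∩ {ω | lam (m + 1) ω = ν}) =
      ENNReal.ofReal (d ν * d (rem ν a) / (m + 1).factorial)) := by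
  have key : ∀ m, (∀ ν ∈ Y m, P {ω | lam m ω = ν} = ENNReal.ofReal (d ν ^ 2 / m.factorial)) →
    (∀ ν ∈ Y (m + 1), ∀ a ∈ R ν, P ({ω | lam m ω = rem ν a} ∩ {ω | lam (m + 1) ω = ν}) =
      ENNReal.ofReal (d ν * d (rem ν a) / (m + 1).factorial)) := by
    intro m hm ν hν a ha
    have hc := card_rem (mem_R.1 ha)
    rw [mem_Y] at hν
    rw [P_joint h, hm _ (mem_Y.2 (by omega)), TT, if_pos (step_iff_rem.2 ⟨a, ha, rfl⟩),
      ← ENNReal.ofReal_mul (div_nonneg (sq_nonneg _) (fac_pos _).le), Nat.factorial_succ]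
    congr 1
    have := fac_ne m
    have hd := (d_pos (rem ν a)).ne'
    push_cast
    field_simp
  suffices hs : ∀ ν ∈ Y m, P {ω | lam m ω = ν} = ENNReal.ofReal (d ν ^ 2 / m.factorial) from
    ⟨hs, key m hs⟩
  induction m with
  | zero =>
    intro ν hν
    rw [Y_zero, Finset.mem_singleton] at hν
    subst hν
    have h1 := P_atom h (m := 0) (π := fun _ => ⊥) ⟨rfl, by intro i hi; omega⟩
    have e : atom lam 0 (fun _ => ⊥) = {ω | lam 0 ω = ⊥} := by
      ext ω; simp [atom]
    rw [← e, h1, d_bot]; simp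
  | succ m ih =>
    intro ν hν
    have h1 : P {ω | lam (m + 1) ω = ν} =
      P (⋃ a ∈ R ν, ({ω | lam m ω = rem ν a} ∩ {ω | lam (m + 1) ω = ν})) := by
      apply measure_congr
      filter_upwards [ae_step h] with ω hω
      apply propext
      constructor
      · intro h2
        have h2' : lam (m + 1) ω = ν := h2
        have h3 := hω m
        rw [h2'] at h3
        obtain ⟨a, ha, h4⟩ := step_iff_rem.1 h3
        exact Set.mem_biUnion ha ⟨h4, h2⟩
      · intro h2
        obtain ⟨a, h3⟩ := Set.mem_iUnion.1 h2
        obtain ⟨_, h4⟩ := Set.mem_iUnion.1 h3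
        exact h4.2
    rw [h1, measure_biUnion_finset]
    · rw [Finset.sum_congr rfl (fun a ha => key m ih ν hν a ha),
        ← ENNReal.ofReal_sum_of_nonneg
        (fun b _ => div_nonneg (mul_nonneg (d_nonneg _) (d_nonneg _)) (fac_pos _).le)]
      congr 1
      rw [← Finset.sum_div, ← Finset.mul_sum, ← d_rec (pos_of_Y hν)]
      ring
    · intro a ha b hb hab
      rw [Function.onFun, Set.disjoint_left]
      rintro ω ⟨h1, _⟩ ⟨h2, _⟩
      exact hab (rem_inj ha hb (h1.symm.trans h2))
    · intro b _; exact (h.2.1 _ _).inter (h.2.1 _ _)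

theorem rowIdx_add {k : ℕ} {μ : YoungDiagram} {b : ℕ} (hb : b ∈ A μ) (r : Fin (k + 1)) :
    rowIdx k μ (add μ b) = some r ↔ b = r := by
  have key : ∀ r : ℕ, (add μ b).rowLen r = μ.rowLen r + 1 ↔ b = r := by
    intro r
    rw [rl_add (mem_A.1 hb)]
    split_ifs with h1
    · simp [h1]
    · constructor
      · intro h; omega
      · intro h; exact absurd h.symm h1
  unfold rowIdx
  split_ifs with h
  · have h1 := (key _).1 h.choose_spec
    rw [Option.some_inj]
    constructor
    · intro h2; rw [← h2]; exact h1
    · intro h2; apply Fin.ext; omega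
  · constructor
    · intro h1; simp at h1
    · intro h1; exact absurd ⟨r, (key r).2 h1⟩ h

/-- joint law of indicator and diagram -/
theorem P_J (h : IsPlancherelGrowthProcess P lam) (k m : ℕ) (r : Fin (k + 1)) {ν : YoungDiagram}
    (hν : ν ∈ Y (m + 1)) :
    P ({ω | rowIdx k (lam m ω) (lam (m + 1) ω) = some r} ∩ {ω | lam (m + 1) ω = ν}) =
      ENNReal.ofReal (d ν * g r ν / (m + 1).factorial) := by
  classical
  unfold g
  split_ifs with hr
  · rw [← (P_marg_joint h m).2 ν hν r hr]
    apply measure_congr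
    filter_upwards [ae_step h] with ω hω
    apply propext
    obtain ⟨b, hb, h1⟩ := hω m
    constructor
    · rintro ⟨h2, h3⟩
      have h2' : rowIdx k (lam m ω) (lam (m + 1) ω) = some r := h2
      have h3' : lam (m + 1) ω = ν := h3
      rw [h1, rowIdx_add hb] at h2'
      refine ⟨?_, h3⟩
      show lam m ω = rem ν r
      rw [← h3', h1, ← h2', rem_add (mem_A.1 hb)]
    · rintro ⟨h2, h3⟩
      have h2' : lam m ω = rem ν r := h2
      have h3' : lam (m + 1) ω = ν := h3
      refine ⟨?_, h3⟩
      show rowIdx k (lam m ω) (lam (m + 1) ω) = some r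
      rw [h1, rowIdx_add hb]
      apply add_inj hb (by rw [h2', mem_A]; exact addable_rem (mem_R.1 hr))
      rw [← h1, h3', h2', add_rem (mem_R.1 hr)]
  · rw [mul_zero, zero_div, ENNReal.ofReal_zero, measure_eq_zero_iff_ae_notMem]
    filter_upwards [ae_step h] with ω hω
    rintro ⟨h2, h3⟩
    obtain ⟨b, hb, h1⟩ := hω m
    have h2' : rowIdx k (lam m ω) (lam (m + 1) ω) = some r := h2
    have h3' : lam (m + 1) ω = ν := h3
    rw [h1, rowIdx_add hb] at h2'
    apply hr
    rw [← h3', h1, ← h2']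
    exact mem_R.2 (removable_add (mem_A.1 hb))

end
end PG

namespace PG

section
variable {Ω : Type*} [MeasurableSpace Ω] {P : Measure Ω} {lam : ℕ → Ω → YoungDiagram}

theorem tot_fin {X : Type*} [Fintype X] {f : Ω → X} [IsProbabilityMeasure P]
    (hf : ∀ x, MeasurableSet {ω | f ω = x})
    {B : Set Ω} (hB : MeasurableSet B) : P.real B = ∑ x, P.real (B ∩ {ω | f ω = x}) := by
  unfold Measure.real
  rw [tot hf hB, tsum_fintype, ENNReal.toReal_sum (fun x _ => measure_ne_top _ _)]

theorem tot_Y (h : IsPlancherelGrowthProcess P lam) [IsProbabilityMeasure P] (m : ℕ)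
    {B : Set Ω} (hB : MeasurableSet B) :
    P.real B = ∑ ν ∈ Y m, P.real (B ∩ {ω | lam m ω = ν}) := by
  unfold Measure.real
  rw [tot (h.2.1 m) hB, tsum_eq_sum (s := Y m), ENNReal.toReal_sum (fun x _ => measure_ne_top _ _)]
  intro ν hν
  rw [measure_eq_zero_iff_ae_notMem]
  filter_upwards [ae_card h] with ω hω
  rintro ⟨_, h1⟩
  apply hν
  have h1' : lam m ω = ν := h1
  rw [← h1']; exact hω m

noncomputable def Jr (P : Measure Ω) (lam : ℕ → Ω → YoungDiagram) (k N : ℕ) (o : Option (Fin (k + 1)))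
    (ν : YoungDiagram) : ℝ :=
  P.real ({ω | rowIdx k (lam N ω) (lam (N + 1) ω) = o} ∩ {ω | lam (N + 1) ω = ν})

noncomputable def De (P : Measure Ω) (lam : ℕ → Ω → YoungDiagram) (k N : ℕ) (o : Option (Fin (k + 1)))
    (ν : YoungDiagram) : ℝ :=
  Jr P lam k N o ν - P.real {ω | rowIdx k (lam N ω) (lam (N + 1) ω) = o} *
    P.real {ω | lam (N + 1) ω = ν}

theorem q_real (h : IsPlancherelGrowthProcess P lam) (m : ℕ) {ν} (hν : ν ∈ Y m) :
    P.real {ω | lam m ω = ν} = d ν ^ 2 / m.factorial := by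
  unfold Measure.real
  rw [(P_marg_joint h m).1 ν hν, ENNReal.toReal_ofReal (div_nonneg (sq_nonneg _) (fac_pos _).le)]

theorem Jr_some (h : IsPlancherelGrowthProcess P lam) (k N : ℕ) (r : Fin (k + 1)) {ν}
    (hν : ν ∈ Y (N + 1)) : Jr P lam k N (some r) ν = d ν * g r ν / (N + 1).factorial := by
  unfold Jr Measure.real
  rw [P_J h k N r hν, ENNReal.toReal_ofReal]
  exact div_nonneg (mul_nonneg (d_nonneg _) (g_nonneg _ _)) (fac_pos _).le

theorem R_some (h : IsPlancherelGrowthProcess P lam) (k N : ℕ) (r : Fin (k + 1)) :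
    P.real {ω | rowIdx k (lam N ω) (lam (N + 1) ω) = some r} = p r (N + 1) := by
  have := h.1
  rw [tot_Y h (N + 1) (meas_two h N (fun a b => rowIdx k a b = some r))]
  change ∑ ν ∈ Y (N + 1), Jr P lam k N (some r) ν = _
  rw [Finset.sum_congr rfl (fun ν hν => Jr_some h k N r hν), ← Finset.sum_div]
  rfl

theorem tvJ (h : IsPlancherelGrowthProcess P lam) (k N : ℕ) :
    ∑ o, ∑ ν ∈ Y (N + 1), |De P lam k N o ν| ≤ 2 * cc k (N + 1) := by
  have := h.1
  have hmeas : ∀ o, MeasurableSet {ω | rowIdx k (lam N ω) (lam (N + 1) ω) = o} :=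
    fun o => meas_two h N (fun a b => rowIdx k a b = o)
  have h1 : ∀ r : Fin (k + 1), ∑ ν ∈ Y (N + 1), |De P lam k N (some r) ν| ≤
      Real.sqrt (1 - (Real.sqrt (N + 1 : ℕ) * p r (N + 1)) ^ 2) / Real.sqrt (N + 1 : ℕ) := by
    intro r
    refine le_trans (le_of_eq ?_) (tv_one (N + 1) r (by omega))
    apply Finset.sum_congr rfl
    intro ν hν
    unfold De
    rw [Jr_some h k N r hν, R_some h, q_real h _ hν]
  have hcc : ∑ r : Fin (k + 1), ∑ ν ∈ Y (N + 1), |De P lam k N (some r) ν| ≤ cc k (N + 1) := by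
    unfold cc
    rw [← Fin.sum_univ_eq_sum_range (fun r => Real.sqrt (1 - (Real.sqrt (N + 1 : ℕ) * p r (N + 1)) ^ 2)
      / Real.sqrt (N + 1 : ℕ))]
    exact Finset.sum_le_sum (fun r _ => h1 r)
  have hsum : ∀ ν, ∑ o, De P lam k N o ν = 0 := by
    intro ν
    unfold De Jr
    rw [Finset.sum_sub_distrib, ← Finset.sum_mul]
    have e1 := tot_fin hmeas (P := P) (h.2.1 (N + 1) ν)
    have e2 := tot_fin hmeas (P := P) MeasurableSet.univ
    simp only [Set.univ_inter, probReal_univ] at e2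
    rw [← e2, one_mul]
    conv_lhs => rw [e1]
    simp only [Set.inter_comm, sub_self]
  rw [Fintype.sum_option]
  have hnone : ∑ ν ∈ Y (N + 1), |De P lam k N none ν| ≤
      ∑ r : Fin (k + 1), ∑ ν ∈ Y (N + 1), |De P lam k N (some r) ν| := by
    rw [Finset.sum_comm]
    apply Finset.sum_le_sum
    intro ν _
    have := hsum ν
    rw [Fintype.sum_option] at this
    rw [show De P lam k N none ν = -∑ r, De P lam k N (some r) ν by linarith, abs_neg]
    exact Finset.abs_sum_le_sum_abs _ _
  linarith

theorem cov_le (h : IsPlancherelGrowthProcess P lam) (k N t : ℕ) (o : Option (Fin (k + 1)))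
    (B : ℕ → YoungDiagram → YoungDiagram → Prop) (y : YoungDiagram) :
    |P.real ({ω | rowIdx k (lam N ω) (lam (N + 1) ω) = o} ∩ Fut lam B y (N + 1 + t) (N + 1)) -
      P.real {ω | rowIdx k (lam N ω) (lam (N + 1) ω) = o} * P.real (Fut lam B y (N + 1 + t) (N + 1))| ≤
    ∑ ν ∈ Y (N + 1), |De P lam k N o ν| / P.real {ω | lam (N + 1) ω = ν} *
      P.real ({ω | lam (N + 1) ω = ν} ∩ Fut lam B y (N + 1 + t) (N + 1)) := by
  have := h.1
  obtain ⟨G, hG⟩ := markov_fut h B y t (N + 1)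
  set V := Fut lam B y (N + 1 + t) (N + 1) with hV
  have hVm : MeasurableSet V := meas_Fut h _ _ _ _
  have hR := meas_two h N (fun a b => rowIdx k a b = o)
  have g1 : ∀ ν, P.real ({ω | rowIdx k (lam N ω) (lam (N + 1) ω) = o} ∩ V ∩ {ω | lam (N + 1) ω = ν}) =
      Jr P lam k N o ν * (G ν).toReal := by
    intro ν
    have := hG (fun x => rowIdx k (x ⟨N, by omega⟩) (x ⟨N + 1, by omega⟩) = o) ν
    unfold Jr Measure.real
    rw [← ENNReal.toReal_mul]
    rw [Set.inter_right_comm]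
    exact congrArg ENNReal.toReal this
  have g2 : ∀ ν, P.real ({ω | lam (N + 1) ω = ν} ∩ V) =
      P.real {ω | lam (N + 1) ω = ν} * (G ν).toReal := by
    intro ν
    have := hG (fun x => True) ν
    unfold Measure.real
    rw [← ENNReal.toReal_mul]
    simpa using congrArg ENNReal.toReal this
  have e1 := tot_Y h (N + 1) (hR.inter hVm)
  have e2 := tot_Y h (N + 1) hVm
  rw [e1]
  conv_lhs => rw [e2]
  rw [Finset.mul_sum, ← Finset.sum_sub_distrib]
  refine (Finset.abs_sum_le_sum_abs _ _).trans (Finset.sum_le_sum fun ν hν => ?_)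
  have hq : P.real {ω | lam (N + 1) ω = ν} ≠ 0 := by
    rw [q_real h _ hν]
    have := d_pos ν
    have := fac_pos (N + 1)
    positivity
  rw [g1, Set.inter_comm V, g2, div_mul_eq_mul_div, le_div_iff₀ (lt_of_le_of_ne measureReal_nonneg hq.symm)]
  rw [show Jr P lam k N o ν * (G ν).toReal - P.real {ω | rowIdx k (lam N ω) (lam (N + 1) ω) = o} *
     (P.real {ω | lam (N + 1) ω = ν} * (G ν).toReal) = De P lam k N o ν * (G ν).toReal by unfold De; ring,
     abs_mul, abs_of_nonneg (ENNReal.toReal_nonneg)]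
  apply le_of_eq; ring

end
end PG

namespace PG

section
variable {Ω Ω' : Type*} [MeasurableSpace Ω] [MeasurableSpace Ω'] {P : Measure Ω} {P' : Measure Ω'}
  {lam : ℕ → Ω → YoungDiagram}

def rx {X : Type*} (n ℓ : ℕ) (ρ : Fin ℓ → Option X) (j : ℕ) : Option X :=
  if h : j - n < ℓ then ρ ⟨j - n, h⟩ else none

theorem rx_add {X : Type*} (n ℓ : ℕ) (ρ : Fin ℓ → Option X) (i : Fin ℓ) : rx n ℓ ρ (n + i) = ρ i := by
  unfold rx
  rw [dif_pos (by omega)]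
  congr 1
  ext; simp

def Uu {k : ℕ} (Rt : ℕ → Ω' → Option (Fin (k + 1))) (n M : ℕ) (ρ : ℕ → Option (Fin (k + 1))) : Set Ω' :=
  {ω' | ∀ m ∈ Finset.Ico n M, Rt m ω' = ρ m}

def Vv (lam : ℕ → Ω → YoungDiagram) (k L m : ℕ) (ρ : ℕ → Option (Fin (k + 1))) (y : YoungDiagram) : Set Ω :=
  Fut lam (fun j a b => rowIdx k a b = ρ j) y L m

theorem meas_Uu {k : ℕ} {Rt : ℕ → Ω' → Option (Fin (k + 1))}
    (hRtmeas : ∀ m o, MeasurableSet {ω' | Rt m ω' = o}) (n M : ℕ) (ρ) : MeasurableSet (Uu Rt n M ρ) := by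
  have : Uu Rt n M ρ = ⋂ m ∈ Finset.Ico n M, {ω' | Rt m ω' = ρ m} := by
    ext ω; simp [Uu]
  rw [this]
  exact Finset.measurableSet_biInter _ (fun m _ => hRtmeas m _)

theorem final [IsProbabilityMeasure P'] (hPGP : IsPlancherelGrowthProcess P lam) (k : ℕ)
    (Rt : ℕ → Ω' → Option (Fin (k + 1)))
    (hRtmeas : ∀ m o, MeasurableSet {ω' | Rt m ω' = o})
    (hRt : ∀ (s : Finset ℕ) (ρ : ℕ → Option (Fin (k + 1))),
      P' {ω' | ∀ m ∈ s, Rt m ω' = ρ m} =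
        ∏ m ∈ s, P {ω | rowIdx k (lam m ω) (lam (m + 1) ω) = ρ m}) (n ℓ : ℕ) (i₀ : Fin ℓ) :
        (1 / 2) * ∑' p : (Fin ℓ → Option (Fin (k + 1))) × YoungDiagram,
          |((P.prod P') {z | (∀ i : Fin ℓ,
                (if (i : ℕ) < (i₀ : ℕ) then Rt (n + i) z.2
                  else rowIdx k (lam (n + i) z.1) (lam (n + i + 1) z.1)) = p.1 i) ∧
                lam (n + ℓ) z.1 = p.2}).toReal -
            ((P.prod P') {z | (∀ i : Fin ℓ,
                (if (i : ℕ) ≤ (i₀ : ℕ) then Rt (n + i) z.2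
                  else rowIdx k (lam (n + i) z.1) (lam (n + i + 1) z.1)) = p.1 i) ∧
                lam (n + ℓ) z.1 = p.2}).toReal| ≤
          cc k (n + i₀ + 1) := by
  classical
  have hP := hPGP.1
  obtain ⟨t, ht⟩ : ∃ t, n + ℓ = n + i₀ + 1 + t := ⟨ℓ - i₀ - 1, by omega⟩
  set N := n + (i₀ : ℕ) with hN
  have s1 : ∀ p : (Fin ℓ → Option (Fin (k + 1))) × YoungDiagram,
      {z : Ω × Ω' | (∀ i : Fin ℓ, (if (i : ℕ) < (i₀ : ℕ) then Rt (n + i) z.2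
                  else rowIdx k (lam (n + i) z.1) (lam (n + i + 1) z.1)) = p.1 i) ∧
                lam (n + ℓ) z.1 = p.2} =
      ({ω | rowIdx k (lam N ω) (lam (N + 1) ω) = p.1 i₀} ∩ Vv lam k (N + 1 + t) (N + 1) (rx n ℓ p.1) p.2) ×ˢ
        Uu Rt n N (rx n ℓ p.1) := by
    intro p
    rw [ht]
    ext ⟨ω, ω'⟩
    constructor
    · rintro ⟨h1, h2⟩
      dsimp only at h1 h2
      refine ⟨⟨?_, fun j h3 h4 => ?_, h2⟩, fun m hm => ?_⟩
      · have := h1 i₀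
        rwa [if_neg (by omega)] at this
      · have := h1 ⟨j - n, by omega⟩
        rw [if_neg (by simp only; omega), ← rx_add n ℓ p.1] at this
        simp only [show n + (j - n) = j by omega] at this
        exact this
      · rw [Finset.mem_Ico] at hm
        have := h1 ⟨m - n, by omega⟩
        rw [if_pos (by simp only; omega), ← rx_add n ℓ p.1] at this
        simp only [show n + (m - n) = m by omega] at this
        exact this
    · rintro ⟨⟨h1, h2, h3⟩, h4⟩
      refine ⟨fun i => ?_, h3⟩
      dsimp only at h1 h2 h4 ⊢
      split_ifs with hi
      · rw [← rx_add n ℓ p.1]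
        exact h4 _ (Finset.mem_Ico.2 (by omega))
      · by_cases hi' : i = i₀
        · subst hi'; exact h1
        · have : (i : ℕ) ≠ i₀ := fun h => hi' (Fin.ext h)
          rw [← rx_add n ℓ p.1]
          exact h2 _ (by omega) (by omega)
  have s2 : ∀ p : (Fin ℓ → Option (Fin (k + 1))) × YoungDiagram,
      {z : Ω × Ω' | (∀ i : Fin ℓ, (if (i : ℕ) ≤ (i₀ : ℕ) then Rt (n + i) z.2
                  else rowIdx k (lam (n + i) z.1) (lam (n + i + 1) z.1)) = p.1 i) ∧
                lam (n + ℓ) z.1 = p.2} =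
      (Vv lam k (N + 1 + t) (N + 1) (rx n ℓ p.1) p.2) ×ˢ
        Uu Rt n (N + 1) (rx n ℓ p.1) := by
    intro p
    rw [ht]
    ext ⟨ω, ω'⟩
    constructor
    · rintro ⟨h1, h2⟩
      dsimp only at h1 h2
      refine ⟨⟨fun j h3 h4 => ?_, h2⟩, fun m hm => ?_⟩
      · have := h1 ⟨j - n, by omega⟩
        rw [if_neg (by simp only; omega), ← rx_add n ℓ p.1] at this
        simp only [show n + (j - n) = j by omega] at this
        exact this
      · rw [Finset.mem_Ico] at hm
        have := h1 ⟨m - n, by omega⟩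
        rw [if_pos (by simp only; omega), ← rx_add n ℓ p.1] at this
        simp only [show n + (m - n) = m by omega] at this
        exact this
    · rintro ⟨⟨h2, h3⟩, h4⟩
      refine ⟨fun i => ?_, h3⟩
      dsimp only at h2 h4 ⊢
      split_ifs with hi
      · rw [← rx_add n ℓ p.1]
        exact h4 _ (Finset.mem_Ico.2 (by omega))
      · rw [← rx_add n ℓ p.1]
        exact h2 _ (by omega) (by omega)
  have hU : ∀ ρ : Fin ℓ → Option (Fin (k + 1)), P'.real (Uu Rt n (N + 1) (rx n ℓ ρ)) =
      P'.real (Uu Rt n N (rx n ℓ ρ)) * P.real {ω | rowIdx k (lam N ω) (lam (N + 1) ω) = ρ i₀} := by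
    intro ρ
    unfold Measure.real Uu
    rw [hRt, hRt, Finset.prod_Ico_succ_top (by omega), ENNReal.toReal_mul, hN, rx_add]
  have hb : ∀ p : (Fin ℓ → Option (Fin (k + 1))) × YoungDiagram,
      |((P.prod P') {z | (∀ i : Fin ℓ,
                (if (i : ℕ) < (i₀ : ℕ) then Rt (n + i) z.2
                  else rowIdx k (lam (n + i) z.1) (lam (n + i + 1) z.1)) = p.1 i) ∧
                lam (n + ℓ) z.1 = p.2}).toReal -
            ((P.prod P') {z | (∀ i : Fin ℓ,
                (if (i : ℕ) ≤ (i₀ : ℕ) then Rt (n + i) z.2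
                  else rowIdx k (lam (n + i) z.1) (lam (n + i + 1) z.1)) = p.1 i) ∧
                lam (n + ℓ) z.1 = p.2}).toReal| ≤
      ∑ ν ∈ Y (N + 1), |De P lam k N (p.1 i₀) ν| / P.real {ω | lam (N + 1) ω = ν} *
        (P.prod P').real (({ω | lam (N + 1) ω = ν} ∩ Vv lam k (N + 1 + t) (N + 1) (rx n ℓ p.1) p.2) ×ˢ
        Uu Rt n N (rx n ℓ p.1)) := by
    intro p
    rw [s1, s2, Measure.prod_prod, Measure.prod_prod, ENNReal.toReal_mul, ENNReal.toReal_mul]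
    change |P.real _ * P'.real _ - P.real _ * P'.real _| ≤ _
    rw [hU]
    have hc := cov_le hPGP k N t (p.1 i₀) (fun j a b => rowIdx k a b = rx n ℓ p.1 j) p.2
    have hc' := mul_le_mul_of_nonneg_right hc
      (measureReal_nonneg (μ := P') (s := Uu Rt n N (rx n ℓ p.1)))
    rw [← abs_of_nonneg (measureReal_nonneg (μ := P') (s := Uu Rt n N (rx n ℓ p.1))), ← abs_mul,
      abs_of_nonneg (measureReal_nonneg (μ := P') (s := Uu Rt n N (rx n ℓ p.1))), Finset.sum_mul] at hc'
    refine le_trans (le_of_eq ?_) (hc'.trans (le_of_eq ?_))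
    · unfold Vv; congr 1; ring
    · apply Finset.sum_congr rfl
      intro ν _
      rw [measureReal_prod_prod, mul_assoc]; rfl
  have hts := Real.tsum_le_of_sum_le (f := fun p : (Fin ℓ → Option (Fin (k + 1))) × YoungDiagram =>
      |((P.prod P') {z | (∀ i : Fin ℓ,
                (if (i : ℕ) < (i₀ : ℕ) then Rt (n + i) z.2
                  else rowIdx k (lam (n + i) z.1) (lam (n + i + 1) z.1)) = p.1 i) ∧
                lam (n + ℓ) z.1 = p.2}).toReal -
            ((P.prod P') {z | (∀ i : Fin ℓ,
                (if (i : ℕ) ≤ (i₀ : ℕ) then Rt (n + i) z.2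
                  else rowIdx k (lam (n + i) z.1) (lam (n + i + 1) z.1)) = p.1 i) ∧
                lam (n + ℓ) z.1 = p.2}).toReal|) (c := 2 * cc k (N + 1))
      (fun p => abs_nonneg _) ?_
  · linarith
  intro s
  refine (Finset.sum_le_sum fun p _ => hb p).trans ?_
  refine le_trans ?_ (tvJ hPGP k N)
  rw [← Finset.sum_fiberwise s (fun p => p.1 i₀)]
  refine Finset.sum_le_sum fun o _ => ?_
  rw [Finset.sum_comm]
  refine Finset.sum_le_sum fun ν hν => ?_
  have hq : 0 < P.real {ω | lam (N + 1) ω = ν} := by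
    rw [q_real hPGP _ hν]
    have := d_pos ν
    have := fac_pos (N + 1)
    positivity
  have hsum : ∑ p ∈ s with p.1 i₀ = o, (P.prod P').real
      (({ω | lam (N + 1) ω = ν} ∩ Vv lam k (N + 1 + t) (N + 1) (rx n ℓ p.1) p.2) ×ˢ
        Uu Rt n N (rx n ℓ p.1)) ≤ P.real {ω | lam (N + 1) ω = ν} := by
    rw [← measureReal_biUnion_finset]
    · have e : P.real {ω | lam (N + 1) ω = ν} =
        (P.prod P').real ({ω | lam (N + 1) ω = ν} ×ˢ Set.univ) := by
        rw [measureReal_prod_prod]; simp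
      rw [e]
      refine measureReal_mono ?_
      intro z hz
      simp only [Set.mem_iUnion] at hz
      obtain ⟨p, _, hz⟩ := hz
      exact ⟨hz.1.1, trivial⟩
    · intro p hp p' hp' hne
      rw [Finset.mem_coe, Finset.mem_filter] at hp hp'
      rw [Function.onFun, Set.disjoint_left]
      rintro ⟨ω, ω'⟩ ⟨⟨_, a1, a2⟩, a3⟩ ⟨⟨_, b1, b2⟩, b3⟩
      dsimp only at a1 a2 a3 b1 b2 b3
      apply hne
      apply Prod.ext
      · funext i
        rcases lt_trichotomy (i : ℕ) (i₀ : ℕ) with hi | hi | hi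
        · have x1 := a3 (n + i) (Finset.mem_Ico.2 (by omega))
          have x2 := b3 (n + i) (Finset.mem_Ico.2 (by omega))
          rw [rx_add] at x1 x2
          exact x1.symm.trans x2
        · rw [show i = i₀ from Fin.ext hi, hp.2, hp'.2]
        · have x1 := a1 (n + i) (by omega) (by omega)
          have x2 := b1 (n + i) (by omega) (by omega)
          rw [rx_add] at x1 x2
          exact x1.symm.trans x2
      · exact a2.symm.trans b2
    · intro p _
      exact ((hPGP.2.1 _ _).inter (meas_Fut hPGP _ _ _ _)).prod (meas_Uu hRtmeas _ _ _)
  calc _ = ∑ p ∈ s with p.1 i₀ = o, |De P lam k N o ν| / P.real {ω | lam (N + 1) ω = ν} *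
        (P.prod P').real (({ω | lam (N + 1) ω = ν} ∩ Vv lam k (N + 1 + t) (N + 1) (rx n ℓ p.1) p.2) ×ˢ
        Uu Rt n N (rx n ℓ p.1)) := by
        apply Finset.sum_congr rfl
        intro p hp
        rw [(Finset.mem_filter.1 hp).2]
    _ ≤ |De P lam k N o ν| / P.real {ω | lam (N + 1) ω = ν} * P.real {ω | lam (N + 1) ω = ν} := by
        rw [← Finset.mul_sum]
        exact mul_le_mul_of_nonneg_left hsum (by positivity)
    _ = _ := div_mul_cancel₀ _ hq.ne'

end
end PG

/-- **Replacing one row-growth indicator by an independent copy.**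
Fix `k ≥ 0`, let `R⁽ᵐ⁺¹⁾ = rowIdx k (lam m) (lam (m+1)) ∈ 𝒩` be the row-growth
indicators of a Plancherel growth process `lam` living on `(Ω, P)`, and let
`R̃⁽ᵐ⁺¹⁾ = Rt m`, living on an auxiliary probability space `(Ω', P')`, be mutually
independent random variables (hence, on the product space `Ω × Ω'`, independent of the
process) with `R̃⁽ᵐ⁺¹⁾` distributed as `R⁽ᵐ⁺¹⁾` — this is the content of `hRt`.
Then there is a sequence `c_n = o(1/√n)` such that for every `n`, every `ℓ` and every
`i ∈ {1,…,ℓ}` (encoded as `i₀ = i - 1 : Fin ℓ`), the total variation distance between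
`(R̃⁽ⁿ⁺¹⁾,…,R̃⁽ⁿ⁺ⁱ⁻¹⁾, R⁽ⁿ⁺ⁱ⁾, R⁽ⁿ⁺ⁱ⁺¹⁾,…,R⁽ⁿ⁺ˡ⁾, λ⁽ⁿ⁺ˡ⁾)` and
`(R̃⁽ⁿ⁺¹⁾,…,R̃⁽ⁿ⁺ⁱ⁻¹⁾, R̃⁽ⁿ⁺ⁱ⁾, R⁽ⁿ⁺ⁱ⁺¹⁾,…,R⁽ⁿ⁺ˡ⁾, λ⁽ⁿ⁺ˡ⁾)`
is at most `c_{n+i}`.  Total variation distance is written as half the `ℓ¹` distance of the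
probability mass functions on `𝒩^ℓ × 𝕐`, with respect to the product measure `P.prod P'`. -/
theorem tv_replace_one_growth_indicator {Ω Ω' : Type*} [MeasurableSpace Ω] [MeasurableSpace Ω']
    (P : Measure Ω) (P' : Measure Ω') [IsProbabilityMeasure P']
    (lam : ℕ → Ω → YoungDiagram) (hPGP : IsPlancherelGrowthProcess P lam) (k : ℕ)
    (Rt : ℕ → Ω' → Option (Fin (k + 1)))
    (hRtmeas : ∀ m o, MeasurableSet {ω' | Rt m ω' = o})
    (hRt : ∀ (s : Finset ℕ) (ρ : ℕ → Option (Fin (k + 1))),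
      P' {ω' | ∀ m ∈ s, Rt m ω' = ρ m} =
        ∏ m ∈ s, P {ω | rowIdx k (lam m ω) (lam (m + 1) ω) = ρ m}) :
    ∃ c : ℕ → ℝ,
      (c =o[Filter.atTop] fun n : ℕ => 1 / Real.sqrt n) ∧
      ∀ (n ℓ : ℕ) (i₀ : Fin ℓ),
        (1 / 2) * ∑' p : (Fin ℓ → Option (Fin (k + 1))) × YoungDiagram,
          |((P.prod P') {z | (∀ i : Fin ℓ,
                (if (i : ℕ) < (i₀ : ℕ) then Rt (n + i) z.2
                  else rowIdx k (lam (n + i) z.1) (lam (n + i + 1) z.1)) = p.1 i) ∧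
                lam (n + ℓ) z.1 = p.2}).toReal -
            ((P.prod P') {z | (∀ i : Fin ℓ,
                (if (i : ℕ) ≤ (i₀ : ℕ) then Rt (n + i) z.2
                  else rowIdx k (lam (n + i) z.1) (lam (n + i + 1) z.1)) = p.1 i) ∧
                lam (n + ℓ) z.1 = p.2}).toReal| ≤
          c (n + i₀ + 1) := by
  exact ⟨PG.cc k, PG.cc_o k, fun n ℓ i₀ => PG.final hPGP k Rt hRtmeas hRt n ℓ i₀⟩
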